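/- Let c ∈ (1,2) and ε ∈ (0, min{1/4, 2−c}). There exists C > 0 such that for every integer t ≥ 1, sup over all (ξ₁,ξ₂) ∈ [-1/2,1/2)² of |(1/t)∑_{n=1}^t e^{-2πi(ξ₂⌊n^c⌋ + ξ₁n)} − (1/t)∫_0^t e^{-2πi(ξ₂s^c + ξ₁s)} ds| is at most C·t^{-ε/4}. -/

import Mathlib

open MeasureTheory intervalIntegral

/-- `e x = e^{2πix}` -/
noncomputable def e (x : ℝ) : ℂ := Complex.exp (2 * Real.pi * Complex.I * x)

lemma e_add (x y : ℝ) : e (x + y) = e x * e y := by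
  unfold e; rw [← Complex.exp_add]; congr 1; push_cast; ring

lemma e_eq (x : ℝ) : e x = Complex.exp (((2 * Real.pi * x : ℝ) : ℂ) * Complex.I) := by
  unfold e; congr 1; push_cast; ring

lemma norm_e (x : ℝ) : ‖e x‖ = 1 := by
  rw [e_eq]; exact Complex.norm_exp_ofReal_mul_I _

lemma e_zero : e 0 = 1 := by simp [e]

lemma e_int (m : ℤ) : e (m : ℝ) = 1 := by
  unfold e
  rw [Complex.exp_eq_one_iff]
  exact ⟨m, by push_cast; ring⟩

lemma conj_e (x : ℝ) : (starRingEnd ℂ) (e x) = e (-x) := by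
  rw [e_eq, e_eq, ← Complex.exp_conj]
  congr 1
  simp only [map_mul, Complex.conj_ofReal, Complex.conj_I]
  push_cast; ring

lemma e_cos_sin (x : ℝ) : e x = (Real.cos (2 * Real.pi * x) : ℂ) + Real.sin (2 * Real.pi * x) * Complex.I := by
  rw [e_eq, Complex.exp_mul_I]; push_cast; rfl

lemma continuous_e : Continuous e := by
  unfold e; fun_prop

lemma norm_e_sub (x y : ℝ) : ‖e x - e y‖ ≤ 2 * Real.pi * |x - y| := by
  have h : e x - e y = e y * (e (x - y) - 1) := by
    rw [mul_sub, ← e_add]; simp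
  rw [h, norm_mul, norm_e, one_mul, e_eq]
  have := Real.norm_exp_I_mul_ofReal_sub_one_le (x := 2 * Real.pi * (x - y))
  rw [mul_comm Complex.I] at this
  refine this.trans ?_
  rw [Real.norm_eq_abs, abs_mul, abs_of_pos Real.two_pi_pos]

lemma two_mul_le_sin_pi {ρ d : ℝ} (hρ : 0 < ρ) (h1 : ρ ≤ d) (h2 : d ≤ 1 - ρ) :
    2 * ρ ≤ Real.sin (Real.pi * d) := by
  have hp := Real.pi_pos
  rcases le_total d (1/2) with h | h
  · have := Real.mul_le_sin (x := Real.pi * d) (by nlinarith) (by nlinarith)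
    have h3 : 2 / Real.pi * (Real.pi * d) = 2 * d := by field_simp
    linarith
  · have := Real.mul_le_sin (x := Real.pi * (1 - d)) (by nlinarith) (by nlinarith)
    have h3 : 2 / Real.pi * (Real.pi * (1 - d)) = 2 * (1 - d) := by field_simp
    have h4 : Real.sin (Real.pi * (1 - d)) = Real.sin (Real.pi * d) := by
      rw [mul_sub, mul_one, Real.sin_pi_sub]
    linarith

/-- `cot (π d)` -/
noncomputable def ctp (d : ℝ) : ℝ := Real.cos (Real.pi * d) / Real.sin (Real.pi * d)

lemma abs_ctp_le {ρ d : ℝ} (hρ : 0 < ρ) (h1 : ρ ≤ d) (h2 : d ≤ 1 - ρ) : |ctp d| ≤ 1 / (2 * ρ) := by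
  have hs := two_mul_le_sin_pi hρ h1 h2
  have hs0 : 0 < Real.sin (Real.pi * d) := by linarith
  unfold ctp
  rw [abs_div, abs_of_pos hs0]
  exact div_le_div₀ (by norm_num) (Real.abs_cos_le_one _) (by linarith) hs

lemma ctp_anti {d d' : ℝ} (h0 : 0 < d) (h : d ≤ d') (h1 : d' < 1) : ctp d' ≤ ctp d := by
  have hp := Real.pi_pos
  have s1 : 0 < Real.sin (Real.pi * d) := Real.sin_pos_of_pos_of_lt_pi (by positivity) (by nlinarith)
  have s2 : 0 < Real.sin (Real.pi * d') :=
    Real.sin_pos_of_pos_of_lt_pi (mul_pos hp (by linarith)) (by nlinarith)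
  have s3 : 0 ≤ Real.sin (Real.pi * d' - Real.pi * d) :=
    Real.sin_nonneg_of_nonneg_of_le_pi (by nlinarith) (by nlinarith)
  rw [Real.sin_sub] at s3
  unfold ctp
  rw [div_le_div_iff₀ s2 s1]
  linarith

/-- `1 / (e d - 1)` -/
noncomputable def gg (d : ℝ) : ℂ := -(1/2) - Complex.I / 2 * (ctp d : ℂ)

lemma gg_mul {d : ℝ} (hs : 0 < Real.sin (Real.pi * d)) : gg d * (e d - 1) = 1 := by
  have h1 : 2 * Real.pi * d = 2 * (Real.pi * d) := by ring
  rw [e_cos_sin, h1, Real.cos_two_mul, Real.sin_two_mul]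
  unfold gg ctp
  have hcs := Real.sin_sq_add_cos_sq (Real.pi * d)
  set s := Real.sin (Real.pi * d)
  set k := Real.cos (Real.pi * d)
  have hs' : (s : ℂ) ≠ 0 := by exact_mod_cast hs.ne'
  have hcs' : (s : ℂ)^2 + (k : ℂ)^2 = 1 := by exact_mod_cast hcs
  push_cast
  have hk : (k:ℂ)^2 = 1 - (s:ℂ)^2 := by linear_combination hcs'
  have hI := Complex.I_sq
  field_simp
  linear_combination (- 2 * k * Complex.I) * hk - 2 * (k:ℂ)^2 * s * hI

lemma norm_gg_le {ρ d : ℝ} (hρ : 0 < ρ) (h1 : ρ ≤ d) (h2 : d ≤ 1 - ρ) : ‖gg d‖ ≤ 1 / (2 * ρ) := by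
  have hc := abs_ctp_le hρ h1 h2
  have hr : 2 * ρ ≤ 1 := by linarith
  have h3 : 1 ≤ 1 / (2 * ρ) := by rw [le_div_iff₀ (by positivity)]; linarith
  unfold gg
  calc _ ≤ ‖(-(1/2) : ℂ)‖ + ‖Complex.I / 2 * (ctp d : ℂ)‖ := norm_sub_le _ _
    _ = 1/2 + 1/2 * |ctp d| := by simp
    _ ≤ _ := by linarith

/-- Kuzmin–Landau. -/
lemma kl (x : ℕ → ℝ) (m : ℤ) {ρ : ℝ} (hρ : 0 < ρ) (a b : ℕ)
    (hmon : Monotone (fun n => x (n+1) - x n))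
    (hlo : ∀ n, a ≤ n → n < b → m + ρ ≤ x (n+1) - x n)
    (hhi : ∀ n, a ≤ n → n < b → x (n+1) - x n ≤ m + 1 - ρ) :
    ‖∑ n ∈ Finset.Ico a b, e (x n)‖ ≤ 2 / ρ := by
  rcases Nat.lt_or_ge a b with hab | hab
  swap
  · rw [Finset.Ico_eq_empty (by omega)]; simp; positivity
  set d : ℕ → ℝ := fun n => x (n+1) - x n - m with hd
  have key : ∀ k, a ≤ k → k < b →
      ‖∑ n ∈ Finset.Ico a (k+1), e (x n) - gg (d k) * e (x (k+1))‖ ≤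
        ‖gg (d a)‖ + 1/2 * (ctp (d a) - ctp (d k)) := by
    have gE : ∀ k, a ≤ k → k < b → e (x k) = gg (d k) * (e (x (k+1)) - e (x k)) := by
      intro k h1 h2
      have l := hlo k h1 h2
      have u := hhi k h1 h2
      have hs := two_mul_le_sin_pi hρ (d := d k) (by simp only [hd]; linarith) (by simp only [hd]; linarith)
      have := gg_mul (d := d k) (by linarith)
      have h3 : e (x (k+1)) = e (x k) * e (d k) := by
        have : x (k+1) = x k + d k + m := by simp only [hd]; ring
        rw [this, e_add, e_add, e_int, mul_one]
      rw [h3]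
      linear_combination (-e (x k)) * this
    intro k hk
    induction k, hk using Nat.le_induction with
    | base =>
      intro h
      have := gE a le_rfl h
      simp only [Nat.Ico_succ_singleton, Finset.sum_singleton, sub_self, mul_zero, add_zero]
      have h2 : e (x a) - gg (d a) * e (x (a+1)) = - (gg (d a) * e (x a)) := by
        linear_combination this
      rw [h2, norm_neg, norm_mul, norm_e, mul_one]
    | succ k hk ih =>
      intro h
      have ih := ih (by omega)
      have h1 := gE (k+1) (by omega) h
      rw [Finset.sum_Ico_succ_top (by omega)]
      have h2 : ∑ n ∈ Finset.Ico a (k+1), e (x n) + e (x (k+1)) - gg (d (k+1)) * e (x (k+1+1)) =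
        (∑ n ∈ Finset.Ico a (k+1), e (x n) - gg (d k) * e (x (k+1))) +
         (gg (d k) - gg (d (k+1))) * e (x (k+1)) := by linear_combination h1
      rw [h2]
      refine (norm_add_le _ _).trans ?_
      rw [norm_mul, norm_e, mul_one]
      have h3 : gg (d k) - gg (d (k+1)) = Complex.I / 2 * ((ctp (d (k+1)) - ctp (d k) : ℝ) : ℂ) := by
        unfold gg; push_cast; ring
      have l := hlo k hk (by omega)
      have u := hhi (k+1) (by omega) h
      have h4 : ctp (d (k+1)) ≤ ctp (d k) := by
        apply ctp_anti
        · simp only [hd]; linarith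
        · simp only [hd]; have := hmon (Nat.le_succ k); simp only [Nat.succ_eq_add_one] at this; linarith
        · simp only [hd]; linarith
      rw [h3, norm_mul, Complex.norm_real, Real.norm_eq_abs, abs_of_nonpos (by linarith)]
      simp only [norm_div, Complex.norm_I, Complex.norm_ofNat]
      linarith
  obtain ⟨k, rfl⟩ : ∃ k, b = k + 1 := ⟨b - 1, by omega⟩
  have hk := key k (by omega) (by omega)
  have bd : ∀ k', a ≤ k' → k' < k + 1 → ρ ≤ d k' ∧ d k' ≤ 1 - ρ := fun k' h1 h2 =>
    ⟨by have := hlo k' h1 h2; simp only [hd]; linarith, by have := hhi k' h1 h2; simp only [hd]; linarith⟩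
  obtain ⟨p1, p2⟩ := bd a le_rfl hab
  obtain ⟨q1, q2⟩ := bd k (by omega) (by omega)
  have n1 := norm_gg_le hρ p1 p2
  have n2 := norm_gg_le hρ q1 q2
  have c1 := abs_le.1 (abs_ctp_le hρ p1 p2)
  have c2 := abs_le.1 (abs_ctp_le hρ q1 q2)
  have t1 : ‖∑ n ∈ Finset.Ico a (k+1), e (x n)‖ ≤
    ‖∑ n ∈ Finset.Ico a (k+1), e (x n) - gg (d k) * e (x (k+1))‖ + ‖gg (d k) * e (x (k+1))‖ := by
    have := norm_add_le (∑ n ∈ Finset.Ico a (k+1), e (x n) - gg (d k) * e (x (k+1))) (gg (d k) * e (x (k+1)))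
    simpa using this
  rw [norm_mul, norm_e, mul_one] at t1
  have : 2 / ρ = 4 * (1 / (2 * ρ)) := by field_simp; norm_num
  rw [this]
  linarith [c1.2, c2.1]

lemma split_mono (d : ℕ → ℝ) (hd : Monotone d) (y : ℝ) {a b : ℕ} (hab : a ≤ b) :
    ∃ p, a ≤ p ∧ p ≤ b ∧ (∀ n, a ≤ n → n < p → d n < y) ∧ (∀ n, p ≤ n → n < b → y ≤ d n) := by
  induction b, hab using Nat.le_induction with
  | base => exact ⟨a, le_rfl, le_rfl, fun n _ _ => by omega, fun n _ _ => by omega⟩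
  | succ b hb ih =>
    obtain ⟨p, h1, h2, h3, h4⟩ := ih
    rcases lt_or_ge (d b) y with h | h
    · exact ⟨b+1, by omega, le_rfl, fun n _ h5 => (hd (by omega : n ≤ b)).trans_lt h, fun n _ _ => by omega⟩
    · refine ⟨p, h1, by omega, h3, fun n h5 h6 => ?_⟩
      rcases Nat.lt_or_ge n b with h7 | h7
      · exact h4 n h5 h7
      · exact h.trans (hd h7)

lemma count_gap (d : ℕ → ℝ) {l y ρ : ℝ} (hl : 0 < l) (hρ : 0 ≤ ρ) {a b : ℕ} (hab : a ≤ b)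
    (hgap : ∀ n, n + 1 < b → l ≤ d (n+1) - d n)
    (h1 : ∀ n, a ≤ n → n < b → y ≤ d n) (h2 : ∀ n, a ≤ n → n < b → d n ≤ y + ρ) :
    ((b - a : ℕ) : ℝ) ≤ ρ / l + 1 := by
  rcases Nat.eq_or_lt_of_le hab with h | h
  · subst h; simp; positivity
  have key : ∀ k, a ≤ k → k < b → d a + l * ((k : ℝ) - a) ≤ d k := by
    intro k hk
    induction k, hk using Nat.le_induction with
    | base => intro _; simp
    | succ k hk ih =>
      intro h
      have := ih (by omega)
      have := hgap k h
      push_cast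
      linarith
  obtain ⟨k, rfl⟩ : ∃ k, b = k + 1 := ⟨b - 1, by omega⟩
  have := key k (by omega) (by omega)
  have h3 := h1 a le_rfl h
  have h4 := h2 k (by omega) (by omega)
  rw [Nat.cast_sub hab]
  push_cast
  have : ((k:ℝ) - a) ≤ ρ / l := by rw [le_div_iff₀ hl]; linarith
  linarith

lemma norm_sum_e_le (x : ℕ → ℝ) (a b : ℕ) : ‖∑ n ∈ Finset.Ico a b, e (x n)‖ ≤ ((b - a : ℕ) : ℝ) := by
  refine (norm_sum_le _ _).trans ?_
  simp [norm_e]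

lemma unit_piece (x : ℕ → ℝ) (m : ℤ) {l : ℝ} (hl : 0 < l) {a b : ℕ} (hab : a ≤ b)
    (hmon : Monotone (fun n => x (n+1) - x n))
    (hgap : ∀ n, n + 1 < b → l ≤ (x (n+1+1) - x (n+1)) - (x (n+1) - x n))
    (hlo : ∀ n, a ≤ n → n < b → m ≤ x (n+1) - x n)
    (hhi : ∀ n, a ≤ n → n < b → x (n+1) - x n < m + 1) :
    ‖∑ n ∈ Finset.Ico a b, e (x n)‖ ≤ 4 / Real.sqrt l + 2 := by
  set ρ := Real.sqrt l with hρd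
  have hρ : 0 < ρ := Real.sqrt_pos.2 hl
  have hρl : ρ / l = 1 / ρ := by
    rw [div_eq_div_iff hl.ne' hρ.ne', one_mul]; exact Real.mul_self_sqrt hl.le
  obtain ⟨p, p1, p2, p3, p4⟩ := split_mono _ hmon (m + ρ) hab
  obtain ⟨q, q1, q2, q3, q4⟩ := split_mono _ hmon (m + 1 - ρ) p2
  rw [← Finset.sum_Ico_consecutive _ p1 p2, ← Finset.sum_Ico_consecutive _ q1 q2]
  have A := (norm_sum_e_le x a p).trans (count_gap (fun n => x (n+1) - x n) hl hρ.le p1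
    (fun n h => hgap n (by omega)) (y := m) (fun n h1 h2 => hlo n h1 (by omega))
    (fun n h1 h2 => (p3 n h1 h2).le))
  have B := kl x m hρ p q hmon (fun n h1 h2 => p4 n h1 (by omega)) (fun n h1 h2 => (q3 n h1 h2).le)
  have C := (norm_sum_e_le x q b).trans (count_gap (fun n => x (n+1) - x n) hl hρ.le q2
    (fun n h => hgap n (by omega)) (y := m + 1 - ρ) (fun n h1 h2 => q4 n h1 h2)
    (fun n h1 h2 => by have := hhi n (by omega) h2; linarith))
  rw [hρl] at A C
  have : 4 / ρ = 1 / ρ + 2 / ρ + 1 / ρ := by ring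
  refine (norm_add_le _ _).trans ?_
  have := norm_add_le (∑ n ∈ Finset.Ico p q, e (x n)) (∑ n ∈ Finset.Ico q b, e (x n))
  linarith

lemma many_pieces (x : ℕ → ℝ) (m : ℤ) {l : ℝ} (hl : 0 < l)
    (hmon : Monotone (fun n => x (n+1) - x n)) (K a b : ℕ) (hab : a ≤ b)
    (hgap : ∀ n, n + 1 < b → l ≤ (x (n+1+1) - x (n+1)) - (x (n+1) - x n))
    (hlo : ∀ n, a ≤ n → n < b → m ≤ x (n+1) - x n)
    (hhi : ∀ n, a ≤ n → n < b → x (n+1) - x n < m + K) :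
    ‖∑ n ∈ Finset.Ico a b, e (x n)‖ ≤ K * (4 / Real.sqrt l + 2) := by
  induction K generalizing b with
  | zero =>
    rcases Nat.eq_or_lt_of_le hab with h | h
    · subst h; simp
    · have := hlo a le_rfl h; have := hhi a le_rfl h; simp at this; linarith
  | succ K ih =>
    obtain ⟨p, p1, p2, p3, p4⟩ := split_mono _ hmon (m + K) hab
    rw [← Finset.sum_Ico_consecutive _ p1 p2]
    have A := ih p p1 (fun n h => hgap n (by omega)) (fun n h1 h2 => hlo n h1 (by omega)) p3
    have B := unit_piece x (m + K) hl p2 hmon hgap (fun n h1 h2 => by push_cast; exact p4 n h1 h2)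
      (fun n h1 h2 => by have := hhi n (by omega) h2; push_cast at this ⊢; linarith)
    refine (norm_add_le _ _).trans ?_
    push_cast
    linarith

/-- discrete second derivative test -/
lemma second_deriv_test (x : ℕ → ℝ) {l V y : ℝ} (hl : 0 < l) (hV : 0 ≤ V)
    (hmon : Monotone (fun n => x (n+1) - x n)) (N : ℕ)
    (hgap : ∀ n, n + 1 < N → l ≤ (x (n+1+1) - x (n+1)) - (x (n+1) - x n))
    (hlo : ∀ n, n < N → y ≤ x (n+1) - x n)
    (hhi : ∀ n, n < N → x (n+1) - x n ≤ y + V) :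
    ‖∑ n ∈ Finset.range N, e (x n)‖ ≤ (V + 2) * (4 / Real.sqrt l + 2) := by
  have := many_pieces x ⌊y⌋ hl hmon (⌊V⌋₊ + 2) 0 N (Nat.zero_le _) hgap
    (fun n _ h => (Int.floor_le y).trans (hlo n h))
    (fun n _ h => by
      have := hhi n h
      have h1 := Int.lt_floor_add_one y
      have h2 := Nat.lt_floor_add_one V
      push_cast
      linarith)
  rw [← Finset.range_eq_Ico] at this
  refine this.trans ?_
  have h2 := Nat.floor_le hV
  have : 0 ≤ 4 / Real.sqrt l + 2 := by positivity
  push_cast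
  gcongr


lemma norm_sum_neg {ι : Type*} (s : Finset ι) (x : ι → ℝ) :
    ‖∑ n ∈ s, e (-(x n))‖ = ‖∑ n ∈ s, e (x n)‖ := by
  have : ∑ n ∈ s, e (-(x n)) = (starRingEnd ℂ) (∑ n ∈ s, e (x n)) := by
    rw [map_sum]; exact Finset.sum_congr rfl fun n _ => (conj_e _).symm
  rw [this, RCLike.norm_conj]

lemma second_diff {c x : ℝ} (hc1 : 1 < c) (hc2 : c < 2) (hx : 0 < x) :
    (c - 1) * (x + 2) ^ (c - 2) ≤ ((x+2) ^ c - (x+1) ^ c) - ((x+1) ^ c - x ^ c) := by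
  obtain ⟨y, hy, hy'⟩ := exists_hasDerivAt_eq_slope (fun z : ℝ => (z+1) ^ c - z ^ c)
    (fun z => c * (z+1) ^ (c-1) - c * z ^ (c-1)) (a := x) (b := x + 1) (by linarith)
    (by
      refine ContinuousOn.sub ?_ ?_
      · exact (ContinuousOn.rpow_const (by fun_prop) (fun z _ => Or.inr (by linarith)))
      · exact (ContinuousOn.rpow_const (by fun_prop) (fun z _ => Or.inr (by linarith))))
    (by
      intro z hz
      refine HasDerivAt.sub ?_ ?_
      · have := (Real.hasDerivAt_rpow_const (x := z + 1) (p := c) (Or.inr hc1.le)).comp z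
          ((hasDerivAt_id z).add_const 1)
        simpa [Function.comp_def] using this
      · exact Real.hasDerivAt_rpow_const (Or.inr hc1.le))
  obtain ⟨w, hw, hw'⟩ := exists_hasDerivAt_eq_slope (fun z : ℝ => z ^ (c-1))
    (fun z => (c-1) * z ^ (c-1-1)) (a := y) (b := y + 1) (by linarith)
    (ContinuousOn.rpow_const (by fun_prop) (fun z _ => Or.inr (by linarith)))
    (by
      intro z hz
      exact Real.hasDerivAt_rpow_const (Or.inl (by linarith [hz.1, hy.1])))
  have e1 : x + 1 + 1 = x + 2 := by ring
  have e2 : c - 1 - 1 = c - 2 := by ring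
  simp only [add_sub_cancel_left, div_one, e1, e2] at hy' hw'
  rw [← hy']
  have h1 : (x+2) ^ (c-2) ≤ w ^ (c-2) :=
    Real.rpow_le_rpow_of_nonpos (by linarith [hw.1, hy.1]) (by linarith [hw.2, hy.2]) (by linarith)
  have h2 : 0 ≤ w ^ (c-2) := Real.rpow_nonneg (by linarith [hw.1, hy.1]) _
  nlinarith [mul_le_mul_of_nonneg_left h1 (by linarith : (0:ℝ) ≤ c - 1), mul_nonneg (by linarith : (0:ℝ) ≤ c - 1) h2]

lemma pow_lip {c T s s' : ℝ} (hc1 : 1 < c) (hc2 : c < 2) (hs : s ∈ Set.Icc 0 T) (hs' : s' ∈ Set.Icc 0 T) :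
    |s ^ c - s' ^ c| ≤ 2 * T ^ (c-1) * |s - s'| := by
  have := (convex_Icc (0:ℝ) T).norm_image_sub_le_of_norm_hasDerivWithin_le (f := fun z : ℝ => z ^ c)
    (f' := fun z => c * z ^ (c-1)) (C := 2 * T ^ (c-1))
    (fun z _ => (Real.hasDerivAt_rpow_const (Or.inr hc1.le)).hasDerivWithinAt)
    (fun z hz => by
      have h0 : 0 ≤ z ^ (c-1) := Real.rpow_nonneg hz.1 _
      have : z ^ (c-1) ≤ T ^ (c-1) := Real.rpow_le_rpow hz.1 hz.2 (by linarith)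
      rw [Real.norm_eq_abs, abs_of_nonneg (by positivity)]
      exact mul_le_mul hc2.le this h0 (by norm_num)) hs' hs
  simpa using this

lemma succ_diff {c : ℝ} (hc1 : 1 < c) (hc2 : c < 2) {n N : ℕ} (hn : n < N) :
    0 ≤ ((n : ℝ) + 2) ^ c - ((n : ℝ) + 1) ^ c ∧
    ((n : ℝ) + 2) ^ c - ((n : ℝ) + 1) ^ c ≤ 4 * (N : ℝ) ^ (c-1) := by
  have hn' : (n : ℝ) + 1 ≤ N := by exact_mod_cast hn
  have hn0 : (0 : ℝ) ≤ n := Nat.cast_nonneg n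
  constructor
  · have : ((n : ℝ) + 1) ^ c ≤ ((n : ℝ) + 2) ^ c := Real.rpow_le_rpow (by linarith) (by linarith) (by linarith)
    linarith
  · have := pow_lip (T := 2 * N) hc1 hc2 (s := n + 2) (s' := n + 1) ⟨by linarith, by linarith⟩ ⟨by linarith, by linarith⟩
    have h2 := le_of_abs_le this
    have h3 : |(n:ℝ) + 2 - (n + 1)| = 1 := by ring_nf; simp
    rw [h3, mul_one, Real.mul_rpow (by norm_num) (by positivity)] at h2
    have h4 : (2:ℝ) ^ (c-1) ≤ 2 := by
      calc (2:ℝ) ^ (c-1) ≤ 2 ^ (1:ℝ) := Real.rpow_le_rpow_of_exponent_le (by norm_num) (by linarith)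
        _ = 2 := by simp
    have h5 : 0 ≤ (N:ℝ) ^ (c-1) := by positivity
    nlinarith

/-- the model phase -/
noncomputable def ph (c θ α : ℝ) (n : ℕ) : ℝ := θ * ((n : ℝ) + 1) ^ c + α * ((n : ℝ) + 1)

lemma ph_diff (c θ α : ℝ) (n : ℕ) :
    ph c θ α (n+1) - ph c θ α n = θ * (((n : ℝ) + 2) ^ c - ((n : ℝ) + 1) ^ c) + α := by
  unfold ph; push_cast
  have : (n : ℝ) + 1 + 1 = n + 2 := by ring
  rw [this]; ring

lemma ph_gap {c θ : ℝ} (α : ℝ) (hc1 : 1 < c) (hc2 : c < 2) (hθ : 0 ≤ θ) (n : ℕ) :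
    θ * ((c - 1) * ((n:ℝ) + 3) ^ (c - 2)) ≤
      (ph c θ α (n+1+1) - ph c θ α (n+1)) - (ph c θ α (n+1) - ph c θ α n) := by
  rw [ph_diff, ph_diff]
  have h := second_diff hc1 hc2 (x := n + 1) (by positivity)
  push_cast
  have e1 : (n : ℝ) + 1 + 2 = n + 3 := by ring
  have e2 : (n : ℝ) + 1 + 1 = n + 2 := by ring
  rw [e1, e2] at h
  rw [e1, e2]
  nlinarith [mul_le_mul_of_nonneg_left h hθ]

lemma ph_mono {c θ : ℝ} (α : ℝ) (hc1 : 1 < c) (hc2 : c < 2) (hθ : 0 ≤ θ) :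
    Monotone (fun n => ph c θ α (n+1) - ph c θ α n) := by
  refine monotone_nat_of_le_succ fun n => ?_
  have h := ph_gap α hc1 hc2 hθ n
  have : 0 ≤ θ * ((c - 1) * ((n:ℝ) + 3) ^ (c - 2)) :=
    mul_nonneg hθ (mul_nonneg (by linarith) (Real.rpow_nonneg (by positivity) _))
  linarith

lemma norm_ph_neg (c θ α : ℝ) (N : ℕ) :
    ‖∑ n ∈ Finset.range N, e (ph c θ α n)‖ = ‖∑ n ∈ Finset.range N, e (ph c (-θ) (-α) n)‖ := by
  rw [← norm_sum_neg]
  congr 2; ext n; congr 1; unfold ph; ring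

lemma pow_test {c θ : ℝ} (α : ℝ) (hc1 : 1 < c) (hc2 : c < 2) (hθ : θ ≠ 0) {N : ℕ} (hN : 1 ≤ N) :
    ‖∑ n ∈ Finset.range N, e (ph c θ α n)‖ ≤
      (4 * |θ| * (N : ℝ) ^ (c-1) + 2) * (4 / Real.sqrt (|θ| * ((c-1)/2) * (N : ℝ) ^ (c-2)) + 2) := by
  wlog h : 0 < θ generalizing θ α
  · have h' : 0 < -θ := by
      rcases lt_or_gt_of_ne hθ with h1 | h1
      · linarith
      · exact absurd h1 h
    have := this (-α) h'.ne' h'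
    rwa [← norm_ph_neg, abs_neg] at this
  rw [abs_of_pos h]
  have hN' : (1:ℝ) ≤ N := by exact_mod_cast hN
  have hp : 0 < (N:ℝ) ^ (c-2) := Real.rpow_pos_of_pos (by linarith) _
  refine second_deriv_test (ph c θ α) (y := α) (mul_pos (mul_pos h (by linarith)) hp) (by positivity)
    (ph_mono α hc1 hc2 h.le) N ?_ ?_ ?_
  · intro n hn
    refine le_trans ?_ (ph_gap α hc1 hc2 h.le n)
    rw [mul_assoc]
    refine mul_le_mul_of_nonneg_left ?_ h.le
    have hn' : (n:ℝ) + 2 ≤ N := by exact_mod_cast hn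
    have h1 : (2 * (N:ℝ)) ^ (c-2) ≤ ((n:ℝ) + 3) ^ (c-2) :=
      Real.rpow_le_rpow_of_nonpos (by positivity) (by linarith) (by linarith)
    rw [Real.mul_rpow (by norm_num) (by linarith)] at h1
    have h2 : (1/2:ℝ) ≤ 2 ^ (c-2) := by
      calc (1/2:ℝ) = 2 ^ (-1:ℝ) := by rw [Real.rpow_neg_one]; norm_num
        _ ≤ _ := Real.rpow_le_rpow_of_exponent_le (by norm_num) (by linarith)
    have h3 : 1/2 * (N:ℝ) ^ (c-2) ≤ ((n:ℝ) + 3) ^ (c-2) := le_trans (by gcongr) h1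
    nlinarith [mul_le_mul_of_nonneg_left h3 (by linarith : (0:ℝ) ≤ c - 1)]
  · intro n hn
    rw [ph_diff]
    nlinarith [mul_nonneg h.le (succ_diff hc1 hc2 hn).1]
  · intro n hn
    rw [ph_diff]
    nlinarith [mul_le_mul_of_nonneg_left (succ_diff hc1 hc2 hn).2 h.le]

lemma first_test {c θ α : ℝ} (hc1 : 1 < c) (hc2 : c < 2) {N : ℕ} (hα : α ≠ 0)
    (h8 : 8 * |θ| * (N : ℝ) ^ (c-1) ≤ |α|) (hα2 : |α| ≤ 1/2) :
    ‖∑ n ∈ Finset.range N, e (ph c θ α n)‖ ≤ 4 / |α| := by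
  wlog h : 0 ≤ θ generalizing θ α
  · have := this (θ := -θ) (α := -α) (neg_ne_zero.2 hα) (by simpa using h8) (by simpa using hα2) (by linarith)
    rwa [← norm_ph_neg, abs_neg] at this
  rw [abs_of_nonneg h] at h8
  have hpos : 0 < |α| := abs_pos.2 hα
  have hb : ∀ n, n < N → α ≤ ph c θ α (n+1) - ph c θ α n ∧ ph c θ α (n+1) - ph c θ α n ≤ α + |α|/2 := by
    intro n hn
    rw [ph_diff]
    obtain ⟨a1, a2⟩ := succ_diff hc1 hc2 hn
    constructor
    · nlinarith [mul_nonneg h a1]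
    · nlinarith [mul_le_mul_of_nonneg_left a2 h]
  have e4 : 4 / |α| = 2 / (|α|/2) := by field_simp; norm_num
  rw [e4, Finset.range_eq_Ico]
  rcases lt_or_gt_of_ne hα with h1 | h1
  · rw [abs_of_neg h1] at *
    refine kl (ph c θ α) (-1) (by linarith) 0 N (ph_mono α hc1 hc2 h) ?_ ?_
    · intro n _ hn; have := (hb n hn).1; push_cast; linarith
    · intro n _ hn; have := (hb n hn).2; push_cast; linarith
  · rw [abs_of_pos h1] at *
    refine kl (ph c θ α) 0 (by linarith) 0 N (ph_mono α hc1 hc2 h) ?_ ?_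
    · intro n _ hn; have := (hb n hn).1; push_cast; linarith
    · intro n _ hn; have := (hb n hn).2; push_cast; linarith

lemma riemann (F : ℝ → ℝ) (hF : Continuous F) {h L : ℝ} (hh : 0 < h) (hL0 : 0 ≤ L) (K : ℕ)
    (hL : ∀ s ∈ Set.Icc 0 (K * h), ∀ s' ∈ Set.Icc 0 (K * h), |F s - F s'| ≤ L * |s - s'|) :
    ‖(∫ s in (0:ℝ)..(K * h), e (F s)) - h * ∑ m ∈ Finset.range K, e (F ((m + 1) * h))‖ ≤
      K * h * (2 * Real.pi * L * h) := by
  have hc : Continuous fun s => e (F s) := continuous_e.comp hF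
  have h1 := intervalIntegral.sum_integral_adjacent_intervals (f := fun s => e (F s)) (μ := volume)
    (a := fun k : ℕ => k * h) (n := K) (fun k _ => hc.intervalIntegrable _ _)
  simp only [Nat.cast_zero, zero_mul] at h1
  rw [← h1, Finset.mul_sum, ← Finset.sum_sub_distrib]
  refine (norm_sum_le _ _).trans ?_
  have : ∀ k ∈ Finset.range K, ‖(∫ s in ((k:ℝ) * h)..(((k+1 : ℕ):ℝ) * h), e (F s)) - h * e (F ((k + 1) * h))‖ ≤
      h * (2 * Real.pi * L * h) := by
    intro k hk
    have hkK : (k:ℝ) + 1 ≤ K := by exact_mod_cast Finset.mem_range.1 hk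
    have hk0 : (0:ℝ) ≤ k := Nat.cast_nonneg k
    have h2 : (h : ℂ) * e (F ((k + 1) * h)) = ∫ s in ((k:ℝ) * h)..(((k+1 : ℕ):ℝ) * h), e (F ((k + 1) * h)) := by
      rw [intervalIntegral.integral_const]
      have : (((k+1 : ℕ):ℝ) * h - k * h) = h := by push_cast; ring
      rw [this]; rfl
    rw [h2, ← intervalIntegral.integral_sub (hc.intervalIntegrable _ _) (by simp)]
    have h3 := intervalIntegral.norm_integral_le_of_norm_le_const (a := (k:ℝ) * h) (b := (((k+1 : ℕ):ℝ) * h))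
      (f := fun s => e (F s) - e (F ((k + 1) * h))) (C := 2 * Real.pi * L * h) (by
        intro s hs
        push_cast at hs
        rw [Set.uIoc_of_le (by nlinarith)] at hs
        refine (norm_e_sub _ _).trans ?_
        have a1 := hL s ⟨by nlinarith [hs.1], by nlinarith [hs.2]⟩ ((k+1)*h) ⟨by positivity, by nlinarith⟩
        have a2 : |s - (k+1)*h| ≤ h := by
          rw [abs_le]; constructor <;> nlinarith [hs.1, hs.2]
        have a3 := mul_le_mul_of_nonneg_left a2 hL0
        have := mul_le_mul_of_nonneg_left (a1.trans a3) Real.two_pi_pos.le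
        linarith)
    have h4 : |((k+1 : ℕ):ℝ) * h - k * h| = h := by
      have : (((k+1 : ℕ):ℝ) * h - k * h) = h := by push_cast; ring
      rw [this, abs_of_pos hh]
    rw [h4] at h3
    linarith
  refine (Finset.sum_le_sum this).trans ?_
  simp
  linarith

lemma phase_lip {c ξ α T s s' : ℝ} (hc1 : 1 < c) (hc2 : c < 2) (hs : s ∈ Set.Icc 0 T) (hs' : s' ∈ Set.Icc 0 T) :
    |(ξ * s ^ c + α * s) - (ξ * s' ^ c + α * s')| ≤ (2 * |ξ| * T ^ (c-1) + |α|) * |s - s'| := by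
  have h := pow_lip hc1 hc2 hs hs'
  have e1 : (ξ * s ^ c + α * s) - (ξ * s' ^ c + α * s') = ξ * (s^c - s'^c) + α * (s - s') := by ring
  rw [e1]
  refine (abs_add_le _ _).trans ?_
  rw [abs_mul, abs_mul]
  nlinarith [mul_le_mul_of_nonneg_left h (abs_nonneg ξ)]

lemma phase_cont {c ξ α : ℝ} (hc1 : 1 < c) : Continuous fun s : ℝ => ξ * s ^ c + α * s := by
  have : Continuous fun s : ℝ => s ^ c := Real.continuous_rpow_const (by linarith)
  fun_prop

/-- sum versus integral, trivial comparison -/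
lemma box_compare {c ξ α : ℝ} (hc1 : 1 < c) (hc2 : c < 2) (t : ℕ) :
    ‖(∫ s in (0:ℝ)..t, e (ξ * s ^ c + α * s)) - ∑ m ∈ Finset.range t, e (ph c ξ α m)‖ ≤
      t * (2 * Real.pi * (2 * |ξ| * (t:ℝ) ^ (c-1) + |α|)) := by
  have := riemann (fun s => ξ * s ^ c + α * s) (phase_cont hc1) (h := 1) (L := 2 * |ξ| * (t:ℝ) ^ (c-1) + |α|)
    one_pos (by positivity) t (fun s hs s' hs' => phase_lip hc1 hc2 (by simpa using hs) (by simpa using hs'))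
  simpa [ph] using this

lemma integral_approx {c ξ α : ℝ} (hc1 : 1 < c) (hc2 : c < 2) (hξ : |ξ| ≤ 1/2) (hα : |α| ≤ 1/2)
    {t : ℕ} (ht : 1 ≤ t) :
    ‖∫ s in (0:ℝ)..t, e (ξ * s ^ c + α * s)‖ ≤
      ((t:ℝ)^2)⁻¹ * ‖∑ m ∈ Finset.range (t * t^2), e (ph c (ξ * (((t:ℝ)^2)⁻¹)^c) (α * ((t:ℝ)^2)⁻¹) m)‖ + 16 := by
  have ht' : (1:ℝ) ≤ t := by exact_mod_cast ht
  set h : ℝ := ((t:ℝ)^2)⁻¹ with hh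
  have hpos : 0 < h := by positivity
  have hK : ((t * t^2 : ℕ) : ℝ) * h = t := by push_cast; rw [hh]; field_simp
  have := riemann (fun s => ξ * s ^ c + α * s) (phase_cont hc1) (h := h) (L := 2 * |ξ| * (t:ℝ) ^ (c-1) + |α|)
    hpos (by positivity) (t * t^2) (fun s hs s' hs' => phase_lip hc1 hc2 (by rwa [hK] at hs) (by rwa [hK] at hs'))
  rw [hK] at this
  have h2 : ∀ m : ℕ, ξ * (((m:ℝ) + 1) * h) ^ c + α * (((m:ℝ) + 1) * h) = ph c (ξ * h^c) (α * h) m := by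
    intro m
    unfold ph
    rw [Real.mul_rpow (by positivity) hpos.le]; ring
  simp only [h2] at this
  have h3 : (t:ℝ) * (2 * Real.pi * (2 * |ξ| * (t:ℝ) ^ (c-1) + |α|) * h) ≤ 16 := by
    have a1 : (t:ℝ) ^ (c-1) ≤ t := by
      calc (t:ℝ) ^ (c-1) ≤ (t:ℝ) ^ (1:ℝ) := Real.rpow_le_rpow_of_exponent_le ht' (by linarith)
        _ = t := by simp
    have a2 : 2 * |ξ| * (t:ℝ) ^ (c-1) + |α| ≤ 2 * t := by nlinarith [abs_nonneg ξ]
    have a3 : (t:ℝ) * (2 * t) * h = 2 := by rw [hh]; field_simp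
    have a4 : (t:ℝ) * (2 * |ξ| * (t:ℝ) ^ (c-1) + |α|) * h ≤ (t:ℝ) * (2 * t) * h := by gcongr
    have := Real.pi_lt_four
    rw [a3] at a4
    nlinarith [mul_le_mul_of_nonneg_left a4 Real.two_pi_pos.le]
  have h4 := norm_sub_norm_le (∫ s in (0:ℝ)..t, e (ξ * s ^ c + α * s))
    (h * ∑ m ∈ Finset.range (t * t^2), e (ph c (ξ * h^c) (α * h) m))
  rw [norm_mul, Complex.norm_real, Real.norm_eq_abs, abs_of_pos hpos] at h4
  linarith

lemma integral_first {c ξ α : ℝ} (hc1 : 1 < c) (hc2 : c < 2) (hξ : |ξ| ≤ 1/2) (hα : |α| ≤ 1/2)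
    {t : ℕ} (ht : 1 ≤ t) (hα0 : α ≠ 0) (h8 : 8 * |ξ| * (t : ℝ) ^ (c-1) ≤ |α|) :
    ‖∫ s in (0:ℝ)..t, e (ξ * s ^ c + α * s)‖ ≤ 4 / |α| + 16 := by
  have ht' : (1:ℝ) ≤ t := by exact_mod_cast ht
  refine (integral_approx hc1 hc2 hξ hα ht).trans ?_
  set N : ℝ := (t:ℝ)^2 with hN
  have hN1 : 1 ≤ N := one_le_pow₀ ht'
  have hN0 : 0 < N := by linarith
  have hNi : N⁻¹ ≤ 1 := inv_le_one_of_one_le₀ hN1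
  have hNp : 0 < N⁻¹ := by positivity
  have h1 := first_test (θ := ξ * (N⁻¹)^c) (α := α * N⁻¹) hc1 hc2 (N := t * t^2)
    (by positivity) (by
      push_cast
      rw [← hN, abs_mul, abs_mul, abs_of_pos hNp, abs_of_pos (Real.rpow_pos_of_pos hNp c),
        Real.mul_rpow (by positivity) hN0.le, Real.inv_rpow hN0.le, Real.rpow_sub_one hN0.ne']
      have : N ^ c ≠ 0 := (Real.rpow_pos_of_pos hN0 c).ne'
      calc _ = (8 * |ξ| * (t : ℝ) ^ (c-1)) * N⁻¹ := by field_simp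
        _ ≤ _ := by gcongr) (by
      rw [abs_mul, abs_of_pos hNp]
      nlinarith [abs_nonneg α])
  rw [abs_mul, abs_of_pos hNp] at h1
  have h2 := mul_le_mul_of_nonneg_left h1 hNp.le
  have hα' : |α| ≠ 0 := by positivity
  have h3 : N⁻¹ * (4 / (|α| * N⁻¹)) = 4 / |α| := by field_simp
  linarith

lemma integral_second {c ξ α : ℝ} (hc1 : 1 < c) (hc2 : c < 2) (hξ : |ξ| ≤ 1/2) (hα : |α| ≤ 1/2)
    {t : ℕ} (ht : 1 ≤ t) (hξ0 : ξ ≠ 0) :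
    ‖∫ s in (0:ℝ)..t, e (ξ * s ^ c + α * s)‖ ≤
      16 / Real.sqrt (|ξ| * ((c-1)/2) * (t : ℝ) ^ (c-2)) + 24 := by
  have ht' : (1:ℝ) ≤ t := by exact_mod_cast ht
  refine (integral_approx hc1 hc2 hξ hα ht).trans ?_
  set N : ℝ := (t:ℝ)^2 with hN
  have hN1 : 1 ≤ N := one_le_pow₀ ht'
  have hN0 : 0 < N := by linarith
  have hNi : N⁻¹ ≤ 1 := inv_le_one_of_one_le₀ hN1
  have hNp : 0 < N⁻¹ := by positivity
  have hNc : 0 < N⁻¹ ^ c := Real.rpow_pos_of_pos hNp c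
  have h1 := pow_test (θ := ξ * (N⁻¹)^c) (α := α * N⁻¹) hc1 hc2 (N := t * t^2)
    (mul_ne_zero hξ0 hNc.ne') (by nlinarith [Nat.one_le_pow 2 t ht])
  push_cast at h1
  have hNc' : N ^ c ≠ 0 := (Real.rpow_pos_of_pos hN0 c).ne'
  have e1 : 4 * |ξ * N⁻¹ ^ c| * ((t:ℝ) * (t:ℝ)^2) ^ (c-1) = 4 * |ξ| * (t:ℝ)^(c-1) * N⁻¹ := by
    rw [← hN, abs_mul, abs_of_pos hNc,
        Real.mul_rpow (by positivity) hN0.le, Real.inv_rpow hN0.le, Real.rpow_sub_one hN0.ne']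
    field_simp
  have e2 : |ξ * N⁻¹ ^ c| * ((c-1)/2) * ((t:ℝ) * (t:ℝ)^2) ^ (c-2) =
      (|ξ| * ((c-1)/2) * (t:ℝ)^(c-2)) * (N⁻¹)^2 := by
    rw [← hN, abs_mul, abs_of_pos hNc,
        Real.mul_rpow (by positivity) hN0.le, Real.inv_rpow hN0.le, Real.rpow_sub hN0, Real.rpow_two]
    field_simp
  rw [e1, e2, Real.sqrt_mul' _ (by positivity), Real.sqrt_sq hNp.le] at h1
  set D := Real.sqrt (|ξ| * ((c-1)/2) * (t:ℝ)^(c-2)) with hD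
  have hD0 : 0 < D := by
    apply Real.sqrt_pos.2
    have : 0 < (t:ℝ)^(c-2) := Real.rpow_pos_of_pos (by linarith) _
    have : 0 < |ξ| := abs_pos.2 hξ0
    have : 0 < (c-1)/2 := by linarith
    positivity
  have a1 : (t:ℝ) ^ (c-1) ≤ N := by
    calc (t:ℝ) ^ (c-1) ≤ (t:ℝ) ^ (2:ℝ) := Real.rpow_le_rpow_of_exponent_le ht' (by linarith)
      _ = N := by simp [hN]
  have a2 : 4 * |ξ| * (t:ℝ)^(c-1) * N⁻¹ ≤ 2 := by
    have : (t:ℝ)^(c-1) * N⁻¹ ≤ 1 := by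
      rw [← div_eq_mul_inv]; exact (div_le_one hN0).2 a1
    have h0 : 0 ≤ (t:ℝ)^(c-1) * N⁻¹ := by positivity
    nlinarith [abs_nonneg ξ]
  have a3 : 4 / (D * N⁻¹) + 2 = N * (4 / D) + 2 := by field_simp
  have a4 : 0 ≤ 4 / D := by positivity
  rw [a3] at h1
  have h2 : ‖∑ m ∈ Finset.range (t * t^2), e (ph c (ξ * (N⁻¹)^c) (α * N⁻¹) m)‖ ≤ 4 * (N * (4/D) + 2) := by
    refine h1.trans ?_
    gcongr
    linarith
  have h3 := mul_le_mul_of_nonneg_left h2 hNp.le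
  have h4 : N⁻¹ * (4 * (N * (4/D) + 2)) = 16 / D + 8 * N⁻¹ := by field_simp; ring
  linarith


lemma sq_expand (M : ℕ) (y : ℝ) :
    ((‖∑ k ∈ Finset.range M, e (k * y)‖ ^ 2 : ℝ) : ℂ) =
      ∑ k ∈ Finset.range M, ∑ l ∈ Finset.range M, e (((k:ℝ) - l) * y) := by
  have := Complex.mul_conj' (∑ k ∈ Finset.range M, e (k * y))
  push_cast
  rw [← this, map_sum, Finset.sum_mul_sum]
  refine Finset.sum_congr rfl fun k _ => Finset.sum_congr rfl fun l _ => ?_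
  rw [conj_e, ← e_add]; congr 1; ring

/-- Fejér kernel -/
noncomputable def fej (M : ℕ) (y : ℝ) : ℝ := (M : ℝ)⁻¹ * ‖∑ k ∈ Finset.range M, e (k * y)‖ ^ 2

lemma fej_nonneg (M : ℕ) (y : ℝ) : 0 ≤ fej M y := by unfold fej; positivity

lemma fej_cont (M : ℕ) (y : ℝ) : Continuous fun u => fej M (y - u) := by
  unfold fej
  have : ∀ k : ℕ, Continuous fun u : ℝ => e (k * (y - u)) := fun k => continuous_e.comp (by fun_prop)
  fun_prop

/-- Fourier coefficients -/
noncomputable def AA (θ : ℝ) : ℂ := ∫ u in (0:ℝ)..1, e (-(θ * u))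

lemma e_cont (θ : ℝ) : Continuous fun u : ℝ => e (-(θ * u)) := continuous_e.comp (by fun_prop)

lemma AA_eq {θ : ℝ} (hθ : θ ≠ 0) : AA θ = (e (-θ) - 1) / (-(2 * Real.pi * Complex.I * θ)) := by
  have hne : (-(2 * Real.pi * Complex.I * θ) : ℂ) ≠ 0 := by
    simp [hθ, Real.pi_ne_zero]
  have := integral_exp_mul_complex (a := 0) (b := 1) hne
  unfold AA
  have h : ∀ u : ℝ, e (-(θ * u)) = Complex.exp (-(2 * Real.pi * Complex.I * θ) * u) := by
    intro u; unfold e; congr 1; push_cast; ring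
  simp only [h, this]
  congr 2
  · rw [← h 1, mul_one]
  · simp

lemma AA_le_one (θ : ℝ) : ‖AA θ‖ ≤ 1 := by
  unfold AA
  have := intervalIntegral.norm_integral_le_of_norm_le_const (a := 0) (b := 1) (f := fun u => e (-(θ * u))) (C := 1)
    (fun u _ => (norm_e _).le)
  simpa using this

lemma AA_le {θ : ℝ} (hθ : θ ≠ 0) : ‖AA θ‖ ≤ 1 / |θ| := by
  rw [AA_eq hθ, norm_div]
  have h1 : ‖e (-θ) - 1‖ ≤ 2 := by
    refine (norm_sub_le _ _).trans ?_
    rw [norm_e]; norm_num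
  have h2 : ‖(-(2 * Real.pi * Complex.I * θ) : ℂ)‖ = 2 * Real.pi * |θ| := by
    simp [abs_of_pos Real.pi_pos]
  rw [h2]
  have hp := Real.pi_gt_three
  have : 0 < |θ| := abs_pos.2 hθ
  rw [div_le_div_iff₀ (by positivity) this]
  nlinarith

lemma AA_zero : AA 0 = 1 := by simp [AA, e_zero]

lemma AA_int {j : ℤ} (hj : j ≠ 0) : AA (j : ℝ) = 0 := by
  rw [AA_eq (by exact_mod_cast hj)]
  have : e (-(j:ℝ)) = 1 := by have := e_int (-j); push_cast at this; exact this
  rw [this]; simp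

lemma conv_fej (M : ℕ) (ξ y : ℝ) :
    ∫ u in (0:ℝ)..1, e (-(ξ * u)) * (fej M (y - u) : ℂ) =
      (M:ℂ)⁻¹ * ∑ k ∈ Finset.range M, ∑ l ∈ Finset.range M, e (((k:ℝ) - l) * y) * AA (ξ + (k - l)) := by
  have h : ∀ u : ℝ, e (-(ξ * u)) * (fej M (y - u) : ℂ) =
      (M:ℂ)⁻¹ * ∑ k ∈ Finset.range M, ∑ l ∈ Finset.range M,
        e (((k:ℝ) - l) * y) * e (-((ξ + (k - l)) * u)) := by
    intro u
    unfold fej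
    rw [Complex.ofReal_mul, sq_expand, mul_left_comm, Finset.mul_sum]
    push_cast
    congr 1
    refine Finset.sum_congr rfl fun k _ => ?_
    rw [Finset.mul_sum]
    refine Finset.sum_congr rfl fun l _ => ?_
    rw [← e_add, ← e_add]; congr 1; ring
  simp only [h]
  rw [intervalIntegral.integral_const_mul, intervalIntegral.integral_finsetSum]
  · congr 1
    refine Finset.sum_congr rfl fun k _ => ?_
    rw [intervalIntegral.integral_finsetSum]
    · refine Finset.sum_congr rfl fun l _ => ?_
      rw [intervalIntegral.integral_const_mul]; rfl
    · intro l _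
      exact ((e_cont _).const_mul _).intervalIntegrable _ _
  · intro k _
    exact (continuous_finsetSum _ fun l _ => (e_cont _).const_mul _).intervalIntegrable _ _

lemma fej_mass {M : ℕ} (hM : 1 ≤ M) (y : ℝ) : ∫ u in (0:ℝ)..1, fej M (y - u) = 1 := by
  have h := conv_fej M 0 y
  have h2 : ∀ k ∈ Finset.range M, ∑ l ∈ Finset.range M, e (((k:ℝ) - l) * y) * AA (0 + (k - l)) = 1 := by
    intro k hk
    rw [Finset.sum_eq_single k]
    · simp [AA_zero, e_zero]
    · intro l _ hl
      have : (0:ℝ) + ((k:ℝ) - l) = (((k:ℤ) - (l:ℤ) : ℤ) : ℝ) := by push_cast; ring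
      rw [this, AA_int (by omega), mul_zero]
    · intro h; exact absurd hk h
  rw [Finset.sum_congr rfl h2] at h
  simp only [zero_mul, neg_zero, e_zero, one_mul, Finset.sum_const, Finset.card_range, nsmul_eq_mul, mul_one] at h
  have hM' : (M:ℂ) ≠ 0 := by exact_mod_cast (by omega : M ≠ 0)
  rw [inv_mul_cancel₀ hM'] at h
  have h3 := intervalIntegral.integral_ofReal (a := 0) (b := 1) (μ := volume) (f := fun u => fej M (y - u))
  exact_mod_cast h3.symm.trans h

lemma fej_le {M : ℕ} (hM : 1 ≤ M) {v : ℝ} (hs : Real.sin (Real.pi * v) ≠ 0) :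
    fej M v ≤ (M:ℝ)⁻¹ * (1 / Real.sin (Real.pi * v) ^ 2) := by
  unfold fej
  refine mul_le_mul_of_nonneg_left ?_ (by positivity)
  have h1 : ∀ k : ℕ, e (k * v) = e v ^ k := by
    intro k; unfold e; rw [← Complex.exp_nat_mul]; congr 1; push_cast; ring
  simp only [h1]
  have h2 := geom_sum_mul (e v) M
  have h3 : ‖e v - 1‖ ^ 2 = 4 * Real.sin (Real.pi * v) ^ 2 := by
    rw [e_cos_sin, ← Complex.normSq_eq_norm_sq, Complex.normSq_apply]
    simp only [Complex.add_re, Complex.sub_re, Complex.add_im, Complex.sub_im, Complex.ofReal_re, Complex.ofReal_im,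
      Complex.mul_re, Complex.mul_im, Complex.I_re, Complex.I_im, Complex.one_re, Complex.one_im]
    have : 2 * Real.pi * v = 2 * (Real.pi * v) := by ring
    rw [this, Real.cos_two_mul, Real.sin_two_mul]
    have := Real.sin_sq_add_cos_sq (Real.pi * v)
    have h4 : Real.cos (Real.pi * v) ^ 2 = 1 - Real.sin (Real.pi * v) ^ 2 := by linarith
    nlinarith
  have h4 : ‖e v ^ M - 1‖ ≤ 2 := by
    refine (norm_sub_le _ _).trans ?_
    rw [norm_pow, norm_e]; norm_num
  rw [← h2, norm_mul] at h4
  have h5 : (‖∑ i ∈ Finset.range M, e v ^ i‖ * ‖e v - 1‖) ^ 2 ≤ 2 ^ 2 := by gcongr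
  rw [mul_pow, h3] at h5
  rw [le_div_iff₀ (by positivity)]
  linarith

lemma fej_tail {M : ℕ} (hM : 1 ≤ M) {y a b : ℝ} (hab : a ≤ b)
    (hs : ∀ u ∈ Set.Icc a b, Real.sin (Real.pi * (y - u)) ≠ 0) :
    ∫ u in a..b, fej M (y - u) ≤ (M:ℝ)⁻¹ * (Real.pi⁻¹ * (ctp (y - b) - ctp (y - a))) := by
  have hcont : ContinuousOn (fun u => 1 / Real.sin (Real.pi * (y - u)) ^ 2) (Set.uIcc a b) := by
    rw [Set.uIcc_of_le hab]
    refine ContinuousOn.div (by fun_prop) (by fun_prop) fun u hu => ?_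
    exact pow_ne_zero _ (hs u hu)
  have hintg : IntervalIntegrable (fun u => 1 / Real.sin (Real.pi * (y - u)) ^ 2) volume a b :=
    hcont.intervalIntegrable
  have h1 : ∫ u in a..b, 1 / Real.sin (Real.pi * (y - u)) ^ 2 =
      Real.pi⁻¹ * ctp (y - b) - Real.pi⁻¹ * ctp (y - a) := by
    refine intervalIntegral.integral_eq_sub_of_hasDerivAt (f := fun u => Real.pi⁻¹ * ctp (y - u)) ?_ hintg
    intro u hu
    rw [Set.uIcc_of_le hab] at hu
    have hu := hs u hu
    have d0 : HasDerivAt (fun u => Real.pi * (y - u)) (-Real.pi) u := by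
      have := ((hasDerivAt_id u).const_sub y).const_mul Real.pi
      simpa using this
    have d1 := (d0.cos.div d0.sin hu).const_mul Real.pi⁻¹
    unfold ctp
    refine d1.congr_deriv ?_
    have := Real.sin_sq_add_cos_sq (Real.pi * (y - u))
    have hp := Real.pi_ne_zero
    field_simp
    linear_combination this
  calc _ ≤ ∫ u in a..b, (M:ℝ)⁻¹ * (1 / Real.sin (Real.pi * (y - u)) ^ 2) := by
        refine intervalIntegral.integral_mono_on hab ((fej_cont M y).intervalIntegrable _ _) (hintg.const_mul _) ?_
        intro u hu
        exact fej_le hM (hs u hu)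
    _ = _ := by rw [intervalIntegral.integral_const_mul, h1]; ring

lemma ctp_neg (d : ℝ) : ctp (-d) = - ctp d := by
  unfold ctp; rw [mul_neg, Real.cos_neg, Real.sin_neg, div_neg]

lemma sin_pi_pos {d : ℝ} (h0 : 0 < d) (h1 : d < 1) : 0 < Real.sin (Real.pi * d) :=
  Real.sin_pos_of_pos_of_lt_pi (mul_pos Real.pi_pos h0) (by nlinarith [Real.pi_pos])

/-- the trigonometric polynomial approximating `e (-ξ {y})` -/
noncomputable def PP (M : ℕ) (ξ y : ℝ) : ℂ :=
  (M:ℂ)⁻¹ * ∑ k ∈ Finset.range M, ∑ l ∈ Finset.range M, e (((k:ℝ) - l) * y) * AA (ξ + (k - l))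

lemma PP_err {M : ℕ} (hM : 1 ≤ M) (ξ y : ℝ) :
    e (-(ξ * y)) - PP M ξ y = ∫ u in (0:ℝ)..1, (e (-(ξ * y)) - e (-(ξ * u))) * (fej M (y - u) : ℂ) := by
  have h1 : e (-(ξ * y)) = ∫ u in (0:ℝ)..1, e (-(ξ * y)) * (fej M (y - u) : ℂ) := by
    rw [intervalIntegral.integral_const_mul, intervalIntegral.integral_ofReal, fej_mass hM]; simp
  have hc : Continuous fun u => ((fej M (y - u) : ℝ) : ℂ) := Complex.continuous_ofReal.comp (fej_cont M y)
  conv_lhs => rw [h1]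
  unfold PP
  rw [← conv_fej, ← intervalIntegral.integral_sub]
  · simp only [sub_mul]
  · exact (hc.const_mul _).intervalIntegrable _ _
  · exact ((e_cont ξ).mul hc).intervalIntegrable _ _

lemma piece_bound {M : ℕ} {ξ y a b C : ℝ} (hab : a ≤ b)
    (h : ∀ u ∈ Set.Ioc a b, ‖e (-(ξ * y)) - e (-(ξ * u))‖ ≤ C) :
    ‖∫ u in a..b, (e (-(ξ * y)) - e (-(ξ * u))) * (fej M (y - u) : ℂ)‖ ≤ C * ∫ u in a..b, fej M (y - u) := by
  rw [← intervalIntegral.integral_const_mul]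
  refine intervalIntegral.norm_integral_le_of_norm_le hab ?_ (((fej_cont M y).const_mul _).intervalIntegrable _ _)
  filter_upwards with u hu
  rw [norm_mul, Complex.norm_real, Real.norm_eq_abs, abs_of_nonneg (fej_nonneg _ _)]
  exact mul_le_mul_of_nonneg_right (h u hu) (fej_nonneg _ _)

lemma e_sub_le_two (x y : ℝ) : ‖e x - e y‖ ≤ 2 := by
  refine (norm_sub_le _ _).trans ?_
  rw [norm_e, norm_e]; norm_num

lemma PP_err_two {M : ℕ} (hM : 1 ≤ M) (ξ y : ℝ) : ‖e (-(ξ * y)) - PP M ξ y‖ ≤ 2 := by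
  rw [PP_err hM]
  have := piece_bound (M := M) (ξ := ξ) (y := y) (a := 0) (b := 1) (C := 2) zero_le_one (fun u _ => e_sub_le_two _ _)
  rwa [fej_mass hM, mul_one] at this

lemma PP_err_mid {M : ℕ} (hM : 1 ≤ M) {ξ y η : ℝ} (hξ : |ξ| ≤ 1/2) (hη : 0 < η) (h1 : η ≤ y) (h2 : y ≤ 1 - η) :
    ‖e (-(ξ * y)) - PP M ξ y‖ ≤ 4 * η + 2 / (M * η) := by
  rw [PP_err hM]
  have hc : Continuous fun u => (e (-(ξ * y)) - e (-(ξ * u))) * ((fej M (y - u) : ℝ) : ℂ) :=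
    (continuous_const.sub (e_cont ξ)).mul (Complex.continuous_ofReal.comp (fej_cont M y))
  have hi := fun a b => hc.intervalIntegrable (μ := volume) a b
  have hj := fun a b => (fej_cont M y).intervalIntegrable (μ := volume) a b
  have s1 := intervalIntegral.integral_add_adjacent_intervals (hi 0 (y - η)) (hi (y - η) 1)
  have s2 := intervalIntegral.integral_add_adjacent_intervals (hi (y - η) (y + η)) (hi (y + η) 1)
  have r1 := intervalIntegral.integral_add_adjacent_intervals (hj 0 (y - η)) (hj (y - η) 1)
  have r2 := intervalIntegral.integral_add_adjacent_intervals (hj (y - η) (y + η)) (hj (y + η) 1)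
  have hm := fej_mass hM y
  have b1 := piece_bound (M := M) (ξ := ξ) (y := y) (a := 0) (b := y - η) (C := 2) (by linarith) (fun u _ => e_sub_le_two _ _)
  have b3 := piece_bound (M := M) (ξ := ξ) (y := y) (a := y + η) (b := 1) (C := 2) (by linarith) (fun u _ => e_sub_le_two _ _)
  have b2 := piece_bound (M := M) (ξ := ξ) (y := y) (a := y - η) (b := y + η) (C := 4 * η) (by linarith) (fun u hu => by
    refine (norm_e_sub _ _).trans ?_
    have : |-(ξ * y) - -(ξ * u)| ≤ 1/2 * η := by
      have : -(ξ * y) - -(ξ * u) = ξ * (u - y) := by ring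
      rw [this, abs_mul]
      have : |u - y| ≤ η := by rw [abs_le]; constructor <;> linarith [hu.1, hu.2]
      exact mul_le_mul hξ this (abs_nonneg _) (by norm_num)
    have hp := Real.pi_lt_four
    nlinarith [mul_le_mul_of_nonneg_left this Real.two_pi_pos.le])
  have p1 : 0 ≤ ∫ u in (0:ℝ)..(y-η), fej M (y - u) :=
    intervalIntegral.integral_nonneg (by linarith) fun u _ => fej_nonneg _ _
  have p3 : 0 ≤ ∫ u in (y+η)..1, fej M (y - u) :=
    intervalIntegral.integral_nonneg (by linarith) fun u _ => fej_nonneg _ _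
  have t1 := fej_tail hM (y := y) (a := 0) (b := y - η) (by linarith) (fun u hu =>
    (sin_pi_pos (by linarith [hu.2]) (by linarith [hu.1])).ne')
  have t3 := fej_tail hM (y := y) (a := y + η) (b := 1) (by linarith) (fun u hu => by
    have := sin_pi_pos (d := u - y) (by linarith [hu.1]) (by linarith [hu.2])
    have h : Real.pi * (y - u) = -(Real.pi * (u - y)) := by ring
    rw [h, Real.sin_neg]; exact neg_ne_zero.2 this.ne')
  have e1 : y - (y - η) = η := by ring
  have e2 : y - 1 = -(1 - y) := by ring
  have e3 : y - (y + η) = -η := by ring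
  rw [e1, sub_zero] at t1
  rw [e2, e3, ctp_neg, ctp_neg] at t3
  have c1 := abs_le.1 (abs_ctp_le hη le_rfl (by linarith : η ≤ 1 - η))
  have c2 := abs_le.1 (abs_ctp_le hη h1 h2)
  have c3 := abs_le.1 (abs_ctp_le hη (by linarith : η ≤ 1 - y) (by linarith))
  have hM' : (0:ℝ) < M := by exact_mod_cast hM
  have bound : ∀ z, z ≤ 1 / η → (M:ℝ)⁻¹ * (Real.pi⁻¹ * z) ≤ 1 / (2 * (M * η)) := by
    intro z hz
    have hp := Real.pi_gt_three
    have : Real.pi⁻¹ ≤ 1/2 := by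
      rw [inv_le_comm₀ (by positivity) (by norm_num)]; linarith
    calc (M:ℝ)⁻¹ * (Real.pi⁻¹ * z) ≤ (M:ℝ)⁻¹ * (Real.pi⁻¹ * (1/η)) := by gcongr
      _ ≤ (M:ℝ)⁻¹ * (1/2 * (1/η)) := by gcongr
      _ = _ := by field_simp
  have ee : 1 / η = 1 / (2 * η) + 1 / (2 * η) := by field_simp; norm_num
  have t1' := t1.trans (bound _ (by linarith [c1.2, c2.1]))
  have t3' := t3.trans (bound _ (by linarith [c1.2, c3.1]))
  rw [← s1, ← s2]
  have n1 := norm_add_le (∫ u in (0:ℝ)..(y-η), (e (-(ξ * y)) - e (-(ξ * u))) * ((fej M (y - u) : ℝ) : ℂ))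
    ((∫ u in (y-η)..(y+η), (e (-(ξ * y)) - e (-(ξ * u))) * ((fej M (y - u) : ℝ) : ℂ)) +
     ∫ u in (y+η)..1, (e (-(ξ * y)) - e (-(ξ * u))) * ((fej M (y - u) : ℝ) : ℂ))
  have n2 := norm_add_le (∫ u in (y-η)..(y+η), (e (-(ξ * y)) - e (-(ξ * u))) * ((fej M (y - u) : ℝ) : ℂ))
     (∫ u in (y+η)..1, (e (-(ξ * y)) - e (-(ξ * u))) * ((fej M (y - u) : ℝ) : ℂ))
  have mid1 : ∫ u in (y-η)..(y+η), fej M (y - u) ≤ 1 := by linarith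
  have mid2 := mul_le_mul_of_nonneg_left mid1 (by linarith : 0 ≤ 4 * η)
  have fe : 2 / (M * η) = 4 * (1 / (2 * (M * η))) := by field_simp; norm_num
  rw [fe]
  linarith

lemma big_near {K : ℕ} (y : ℝ) (z : ℤ) (hy : |y - z| * (6 * K) ≤ 1) :
    (K:ℝ)/2 ≤ ‖∑ k ∈ Finset.range K, e (k * y)‖ := by
  refine le_trans ?_ (Complex.re_le_norm _)
  rw [Complex.re_sum]
  have : ∀ k ∈ Finset.range K, (1/2 : ℝ) ≤ (e (k * y)).re := by
    intro k hk
    have hk' : (k:ℝ) ≤ K := by exact_mod_cast (Finset.mem_range.1 hk).le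
    have h1 : e (k * y) = e (k * (y - z)) := by
      have : (k:ℝ) * y = k * (y - z) + ((k * z : ℤ) : ℝ) := by push_cast; ring
      rw [this, e_add, e_int, mul_one]
    rw [h1, e_cos_sin]
    simp only [Complex.add_re, Complex.ofReal_re, Complex.mul_re, Complex.ofReal_im, Complex.I_re, Complex.I_im]
    have h2 : |2 * Real.pi * (k * (y - z))| ≤ Real.pi / 3 := by
      rw [abs_mul, abs_of_pos Real.two_pi_pos, abs_mul, abs_of_nonneg (Nat.cast_nonneg k : (0:ℝ) ≤ k)]
      have := mul_le_mul_of_nonneg_right hk' (abs_nonneg (y - z))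
      nlinarith [Real.pi_pos]
    rw [← Real.cos_abs]
    have := Real.cos_le_cos_of_nonneg_of_le_pi (abs_nonneg _) (by linarith [Real.pi_pos]) h2
    rw [Real.cos_pi_div_three] at this
    linarith
  have := Finset.sum_le_sum this
  simp at this
  linarith

lemma PP_err_all {K : ℕ} (hK : 1 ≤ K) {ξ y : ℝ} (hξ : |ξ| ≤ 1/2) (h0 : 0 ≤ y) (h1 : y < 1) :
    ‖e (-(ξ * y)) - PP (K^2) ξ y‖ ≤ 13 / K + 8 / (K:ℝ)^2 * ‖∑ k ∈ Finset.range K, e (k * y)‖ ^ 2 := by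
  have hK' : (0:ℝ) < K := by exact_mod_cast hK
  have hM : 1 ≤ K^2 := Nat.one_le_pow _ _ hK
  set η : ℝ := 1 / (6 * K) with hη
  have hη0 : 0 < η := by positivity
  have near : ∀ z : ℤ, |y - z| ≤ η →
      ‖e (-(ξ * y)) - PP (K^2) ξ y‖ ≤ 13 / K + 8 / (K:ℝ)^2 * ‖∑ k ∈ Finset.range K, e (k * y)‖ ^ 2 := by
    intro z hz
    have := big_near (K := K) y z (by rwa [hη, le_div_iff₀ (by positivity)] at hz)
    have h3 : ((K:ℝ)/2)^2 ≤ ‖∑ k ∈ Finset.range K, e (k * y)‖ ^ 2 := by gcongr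
    have h4 : 8 / (K:ℝ)^2 * ((K:ℝ)/2)^2 = 2 := by field_simp; norm_num
    have h5 : 8 / (K:ℝ)^2 * ((K:ℝ)/2)^2 ≤ 8 / (K:ℝ)^2 * ‖∑ k ∈ Finset.range K, e (k * y)‖ ^ 2 := by gcongr
    have h6 := PP_err_two hM ξ y
    have : (0:ℝ) ≤ 13 / K := by positivity
    linarith
  rcases lt_or_ge y η with h | h
  · exact near 0 (by simp [abs_of_nonneg h0, h.le])
  rcases lt_or_ge (1 - η) y with h' | h'
  · exact near 1 (by push_cast; rw [abs_le]; constructor <;> linarith)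
  refine (PP_err_mid hM hξ hη0 h h').trans ?_
  have : 4 * η + 2 / (((K^2 : ℕ) : ℝ) * η) ≤ 13 / K := by
    rw [hη]; push_cast
    have : 4 * (1 / (6 * (K:ℝ))) + 2 / ((K:ℝ)^2 * (1 / (6 * K))) = (38/3) / K := by field_simp; norm_num
    rw [this]; gcongr; norm_num
  have : 0 ≤ 8 / (K:ℝ)^2 * ‖∑ k ∈ Finset.range K, e (k * y)‖ ^ 2 := by positivity
  linarith


lemma e_fract (k l : ℕ) (y : ℝ) : e (((k:ℝ) - l) * Int.fract y) = e (((k:ℝ) - l) * y) := by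
  have : ((k:ℝ) - l) * y = ((k:ℝ) - l) * Int.fract y + (((k - l) * ⌊y⌋ : ℤ) : ℝ) := by
    push_cast; rw [← Int.self_sub_floor]; ring
  rw [this, e_add, e_int, mul_one]

lemma PP_fract (M : ℕ) (ξ y : ℝ) : PP M ξ (Int.fract y) = PP M ξ y := by
  unfold PP; simp only [e_fract]

lemma sum_fract (K : ℕ) (y : ℝ) : ∑ k ∈ Finset.range K, e (k * Int.fract y) = ∑ k ∈ Finset.range K, e (k * y) := by
  refine Finset.sum_congr rfl fun k _ => ?_
  simpa using e_fract k 0 y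

lemma sum_inv_sqrt_succ (n : ℕ) : ∑ i ∈ Finset.range n, 1 / Real.sqrt ((i:ℝ) + 1) ≤ 2 * Real.sqrt n := by
  induction n with
  | zero => simp
  | succ n ih =>
    rw [Finset.sum_range_succ]
    push_cast
    set a := Real.sqrt n with ha
    set b := Real.sqrt ((n:ℝ) + 1) with hb
    have hb0 : 0 < b := Real.sqrt_pos.2 (by positivity)
    have ha0 : 0 ≤ a := Real.sqrt_nonneg _
    have h1 : a ^ 2 = n := Real.sq_sqrt (by positivity)
    have h2 : b ^ 2 = n + 1 := Real.sq_sqrt (by positivity)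
    have : 1 / b ≤ 2 * (b - a) := by
      rw [div_le_iff₀ hb0]; nlinarith [sq_nonneg (b - a)]
    linarith

lemma sum_inv_sqrt (n : ℕ) : ∑ i ∈ Finset.range n, 1 / Real.sqrt (i:ℝ) ≤ 2 * Real.sqrt n := by
  cases n with
  | zero => simp
  | succ n =>
    rw [Finset.sum_range_succ']
    simp only [Nat.cast_zero, Real.sqrt_zero, div_zero, add_zero]
    push_cast
    refine (sum_inv_sqrt_succ n).trans ?_
    gcongr
    linarith

lemma sum_inv_sqrt_abs {l M : ℕ} (hl : l < M) :
    ∑ k ∈ Finset.range M, 1 / Real.sqrt |(k:ℝ) - l| ≤ 4 * Real.sqrt M := by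
  rw [Finset.range_eq_Ico, ← Finset.sum_Ico_consecutive _ (Nat.zero_le l) hl.le, ← Finset.range_eq_Ico,
    Finset.sum_Ico_eq_sum_range, ← Finset.sum_range_reflect]
  have h1 : ∑ j ∈ Finset.range l, 1 / Real.sqrt |((l - 1 - j : ℕ):ℝ) - l| = ∑ j ∈ Finset.range l, 1 / Real.sqrt ((j:ℝ) + 1) := by
    refine Finset.sum_congr rfl fun j hj => ?_
    have hj := Finset.mem_range.1 hj
    have : ((l - 1 - j : ℕ):ℝ) = l - 1 - j := by
      rw [Nat.sub_sub, Nat.cast_sub (by omega)]; push_cast; ring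
    rw [this]
    have : (l:ℝ) - 1 - j - l = -(j + 1) := by ring
    rw [this, abs_neg, abs_of_nonneg (by positivity)]
  have h2 : ∑ j ∈ Finset.range (M - l), 1 / Real.sqrt |((l + j : ℕ):ℝ) - l| = ∑ j ∈ Finset.range (M - l), 1 / Real.sqrt (j:ℝ) := by
    refine Finset.sum_congr rfl fun j hj => ?_
    push_cast
    rw [add_sub_cancel_left, abs_of_nonneg (by positivity)]
  rw [h1, h2]
  have a1 := sum_inv_sqrt_succ l
  have a2 := sum_inv_sqrt (M - l)
  have b1 : Real.sqrt l ≤ Real.sqrt M := Real.sqrt_le_sqrt (by exact_mod_cast hl.le)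
  have b2 : Real.sqrt ((M - l : ℕ):ℝ) ≤ Real.sqrt M := Real.sqrt_le_sqrt (by exact_mod_cast Nat.sub_le _ _)
  linarith

lemma floor_sum {t K : ℕ} (hK : 1 ≤ K) (Y β : ℕ → ℝ) {ξ B0 B : ℝ} (hξ : |ξ| ≤ 1/2) (hB0 : 0 ≤ B0) (hB : 0 ≤ B)
    (h0 : ‖∑ n ∈ Finset.range t, e (ξ * Y n + β n)‖ ≤ B0)
    (h1 : ∀ j : ℤ, j ≠ 0 → |j| < K^2 → ‖∑ n ∈ Finset.range t, e ((ξ + j) * Y n + β n)‖ ≤ B * Real.sqrt |(j:ℝ)|)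
    (h2 : ∀ j : ℤ, j ≠ 0 → |j| < K^2 → ‖∑ n ∈ Finset.range t, e (j * Y n)‖ ≤ B * Real.sqrt |(j:ℝ)|) :
    ‖∑ n ∈ Finset.range t, e (ξ * ⌊Y n⌋ + β n)‖ ≤ 21 * t / K + B0 + 16 * (B * K) := by
  have hK' : (0:ℝ) < K := by exact_mod_cast hK
  have hK1 : (1:ℝ) ≤ K := by exact_mod_cast hK
  have hsplit : ∀ n, e (ξ * ⌊Y n⌋ + β n) =
      e (ξ * Y n + β n) * (e (-(ξ * Int.fract (Y n))) - PP (K^2) ξ (Int.fract (Y n))) + e (ξ * Y n + β n) * PP (K^2) ξ (Y n) := by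
    intro n
    rw [PP_fract]
    have : ξ * ⌊Y n⌋ + β n = (ξ * Y n + β n) + -(ξ * Int.fract (Y n)) := by
      rw [← Int.self_sub_floor]; ring
    rw [this, e_add]; ring
  simp only [hsplit, Finset.sum_add_distrib]
  refine (norm_add_le _ _).trans ?_
  have E1 : ‖∑ n ∈ Finset.range t, e (ξ * Y n + β n) * (e (-(ξ * Int.fract (Y n))) - PP (K^2) ξ (Int.fract (Y n)))‖
      ≤ 21 * t / K + 8 * (B * K) := by
    have a1 : ∀ n ∈ Finset.range t, ‖e (ξ * Y n + β n) * (e (-(ξ * Int.fract (Y n))) - PP (K^2) ξ (Int.fract (Y n)))‖ ≤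
        13 / K + 8 / (K:ℝ)^2 * ‖∑ k ∈ Finset.range K, e (k * Y n)‖ ^ 2 := by
      intro n _
      rw [norm_mul, norm_e, one_mul, ← sum_fract]
      exact PP_err_all hK hξ (Int.fract_nonneg _) (Int.fract_lt_one _)
    refine (norm_sum_le _ _).trans ((Finset.sum_le_sum a1).trans ?_)
    rw [Finset.sum_add_distrib, ← Finset.mul_sum]
    have a2 : ∑ n ∈ Finset.range t, ‖∑ k ∈ Finset.range K, e (k * Y n)‖ ^ 2 ≤ K * t + (K:ℝ)^2 * (B * K) := by
      have b1 : ((∑ n ∈ Finset.range t, ‖∑ k ∈ Finset.range K, e (k * Y n)‖ ^ 2 : ℝ) : ℂ) =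
          ∑ k ∈ Finset.range K, ∑ l ∈ Finset.range K, ∑ n ∈ Finset.range t, e (((k:ℝ) - l) * Y n) := by
        rw [Complex.ofReal_sum]
        simp only [sq_expand]
        rw [Finset.sum_comm]
        refine Finset.sum_congr rfl fun k _ => ?_
        rw [Finset.sum_comm]
      have b2 : ‖((∑ n ∈ Finset.range t, ‖∑ k ∈ Finset.range K, e (k * Y n)‖ ^ 2 : ℝ) : ℂ)‖ =
          ∑ n ∈ Finset.range t, ‖∑ k ∈ Finset.range K, e (k * Y n)‖ ^ 2 := by
        rw [Complex.norm_real, Real.norm_eq_abs, abs_of_nonneg (Finset.sum_nonneg fun _ _ => by positivity)]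
      rw [← b2, b1]
      have b3 : ∀ k ∈ Finset.range K, ∀ l ∈ Finset.range K, ‖∑ n ∈ Finset.range t, e (((k:ℝ) - l) * Y n)‖ ≤
          (if l = k then (t:ℝ) else 0) + B * K := by
        intro k hk l hl
        rw [Finset.mem_range] at hk hl
        split_ifs with hkl
        · subst hkl
          refine (norm_sum_le _ _).trans ?_
          simp [norm_e]; positivity
        · have hlt : |(k:ℤ) - l| < K := by rw [abs_lt]; constructor <;> omega
          have hKK : (K:ℤ) ≤ (K:ℤ)^2 := by nlinarith [(by exact_mod_cast hK : (1:ℤ) ≤ K)]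
          have := h2 ((k:ℤ) - l) (by omega) (hlt.trans_le hKK)
          push_cast at this
          refine this.trans ?_
          rw [zero_add]
          have hlt' : |(k:ℝ) - l| ≤ K := by exact_mod_cast hlt.le
          have : Real.sqrt |(k:ℝ) - l| ≤ K := by
            rw [Real.sqrt_le_left hK'.le]; nlinarith
          gcongr
      refine (norm_sum_le _ _).trans ((Finset.sum_le_sum fun k hk =>
        (norm_sum_le _ _).trans (Finset.sum_le_sum (b3 k hk))).trans ?_)
      have : ∀ k ∈ Finset.range K, ∑ l ∈ Finset.range K, ((if l = k then (t:ℝ) else 0) + B * K) = t + K * (B * K) := by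
        intro k hk
        rw [Finset.sum_add_distrib, Finset.sum_ite_eq' (Finset.range K) k, if_pos hk]; simp
      rw [Finset.sum_congr rfl this]
      simp only [Finset.sum_const, Finset.card_range, nsmul_eq_mul]
      apply le_of_eq; ring
    have a3 : 8 / (K:ℝ)^2 * ∑ n ∈ Finset.range t, ‖∑ k ∈ Finset.range K, e (k * Y n)‖ ^ 2 ≤
        8 / (K:ℝ)^2 * (K * t + (K:ℝ)^2 * (B * K)) := by gcongr
    have a4 : 8 / (K:ℝ)^2 * (K * t + (K:ℝ)^2 * (B * K)) = 8 * t / K + 8 * (B * K) := by field_simp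
    simp only [Finset.sum_const, Finset.card_range, nsmul_eq_mul]
    have a5 : 21 * t / (K:ℝ) = t * (13 / K) + 8 * t / K := by ring
    linarith
  have E2 : ‖∑ n ∈ Finset.range t, e (ξ * Y n + β n) * PP (K^2) ξ (Y n)‖ ≤ B0 + 8 * (B * K) := by
    set M := K^2 with hM
    have hM0 : 1 ≤ M := Nat.one_le_pow _ _ hK
    have hM' : (0:ℝ) < M := by exact_mod_cast hM0
    have b1 : ∑ n ∈ Finset.range t, e (ξ * Y n + β n) * PP M ξ (Y n) =
        (M:ℂ)⁻¹ * ∑ k ∈ Finset.range M, ∑ l ∈ Finset.range M, AA (ξ + (k - l)) *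
          ∑ n ∈ Finset.range t, e ((ξ + (k - l)) * Y n + β n) := by
      have : ∀ n, e (ξ * Y n + β n) * PP M ξ (Y n) = (M:ℂ)⁻¹ * ∑ k ∈ Finset.range M, ∑ l ∈ Finset.range M,
          AA (ξ + (k - l)) * e ((ξ + (k - l)) * Y n + β n) := by
        intro n
        unfold PP
        rw [mul_left_comm, Finset.mul_sum]
        congr 1
        refine Finset.sum_congr rfl fun k _ => ?_
        rw [Finset.mul_sum]
        refine Finset.sum_congr rfl fun l _ => ?_
        rw [← mul_assoc, ← e_add, mul_comm]
        congr 2; ring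
      simp only [this]
      rw [← Finset.mul_sum, Finset.sum_comm]
      congr 1
      refine Finset.sum_congr rfl fun k _ => ?_
      rw [Finset.sum_comm]
      refine Finset.sum_congr rfl fun l _ => ?_
      rw [Finset.mul_sum]
    have b3 : ∀ l ∈ Finset.range M, ∀ k ∈ Finset.range M, ‖AA (ξ + (k - l)) *
          ∑ n ∈ Finset.range t, e ((ξ + (k - l)) * Y n + β n)‖ ≤
          (if k = l then B0 else 0) + 2 * B * (1 / Real.sqrt |(k:ℝ) - l|) := by
      intro l hl k hk
      rw [Finset.mem_range] at hk hl
      rw [norm_mul]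
      split_ifs with hkl
      · subst hkl
        simp only [sub_self, add_zero, abs_zero, Real.sqrt_zero, div_zero, mul_zero]
        calc _ ≤ 1 * B0 := mul_le_mul (AA_le_one _) h0 (norm_nonneg _) zero_le_one
          _ = _ := one_mul _
      · have hlt : |(k:ℤ) - l| < (K:ℤ)^2 := by
          have : (K:ℤ)^2 = (M:ℤ) := by rw [hM]; push_cast; rfl
          rw [this, abs_lt]; constructor <;> omega
        have h3 := h1 ((k:ℤ) - l) (by omega) hlt
        push_cast at h3
        have hge : 1 ≤ |(k:ℝ) - l| := by
          have : 1 ≤ |(k:ℤ) - l| := Int.one_le_abs (by omega)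
          exact_mod_cast this
        set j := (k:ℝ) - l with hj
        have hθ : |j| / 2 ≤ |ξ + j| := by
          have := abs_sub_abs_le_abs_sub j (-ξ)
          rw [abs_neg, sub_neg_eq_add, add_comm] at this
          rw [add_comm ξ j]
          rw [add_comm] at this
          linarith
        have hθ0 : ξ + j ≠ 0 := abs_pos.1 (by linarith)
        have hA : ‖AA (ξ + j)‖ ≤ 2 / |j| := by
          refine (AA_le hθ0).trans ?_
          rw [div_le_div_iff₀ (by linarith) (by linarith)]; linarith
        rw [zero_add]
        have hs : Real.sqrt |j| ^ 2 = |j| := Real.sq_sqrt (abs_nonneg _)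
        have hs0 : 0 < Real.sqrt |j| := Real.sqrt_pos.2 (by linarith)
        calc _ ≤ 2 / |j| * (B * Real.sqrt |j|) := mul_le_mul hA h3 (norm_nonneg _) (by positivity)
          _ = _ := by rw [← hs, Real.sqrt_sq hs0.le]; field_simp
    rw [b1, norm_mul, Finset.sum_comm]
    have b4 : ‖∑ l ∈ Finset.range M, ∑ k ∈ Finset.range M, AA (ξ + (k - l)) *
          ∑ n ∈ Finset.range t, e ((ξ + (k - l)) * Y n + β n)‖ ≤ M * (B0 + 8 * (B * K)) := by
      refine (norm_sum_le _ _).trans ((Finset.sum_le_sum fun l hl =>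
        (norm_sum_le _ _).trans (Finset.sum_le_sum (b3 l hl))).trans ?_)
      have : ∀ l ∈ Finset.range M, ∑ k ∈ Finset.range M, ((if k = l then B0 else 0) + 2 * B * (1 / Real.sqrt |(k:ℝ) - l|))
          ≤ B0 + 8 * (B * K) := by
        intro l hl
        rw [Finset.sum_add_distrib, Finset.sum_ite_eq' (Finset.range M) l, if_pos hl, ← Finset.mul_sum]
        have h3 := sum_inv_sqrt_abs (Finset.mem_range.1 hl)
        have h4 : Real.sqrt M = K := by rw [hM]; push_cast; exact Real.sqrt_sq hK'.le
        rw [h4] at h3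
        have := mul_le_mul_of_nonneg_left h3 (by linarith : 0 ≤ 2 * B)
        linarith
      refine (Finset.sum_le_sum this).trans ?_
      simp only [Finset.sum_const, Finset.card_range, nsmul_eq_mul, le_refl]
    have h5 : ‖(M:ℂ)⁻¹‖ = (M:ℝ)⁻¹ := by simp
    rw [h5]
    have := mul_le_mul_of_nonneg_left b4 (by positivity : (0:ℝ) ≤ (M:ℝ)⁻¹)
    rwa [inv_mul_cancel_left₀ hM'.ne'] at this
  linarith


lemma sqrt_split {c θ T : ℝ} (hc1 : 1 < c) (hT : 1 ≤ T) :
    Real.sqrt (|θ| * ((c-1)/2) * T ^ (c-2)) = Real.sqrt |θ| * Real.sqrt ((c-1)/2) * (T ^ (1 - c/2))⁻¹ := by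
  have hT0 : 0 < T := by linarith
  have : T ^ (c-2) = ((T ^ (1 - c/2))⁻¹) ^ 2 := by
    rw [← Real.rpow_neg hT0.le, ← Real.rpow_natCast, ← Real.rpow_mul hT0.le]
    congr 1; push_cast; ring
  rw [this, Real.sqrt_mul (by have := abs_nonneg θ; have : 0 ≤ (c-1)/2 := by linarith
                              positivity), Real.sqrt_sq (by positivity), Real.sqrt_mul (abs_nonneg _)]

/-- `1/√((c-1)/2)` -/
noncomputable def dd (c : ℝ) : ℝ := 1 / Real.sqrt ((c-1)/2)

lemma dd_nonneg (c : ℝ) : 0 ≤ dd c := by unfold dd; positivity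

lemma div_sqrt_split {c θ T A : ℝ} (hc1 : 1 < c) (hT : 1 ≤ T) :
    A / Real.sqrt (|θ| * ((c-1)/2) * T ^ (c-2)) = A * dd c * (T ^ (1 - c/2) / Real.sqrt |θ|) := by
  rw [sqrt_split hc1 hT]
  unfold dd
  rw [div_eq_mul_inv, mul_inv, mul_inv, inv_inv]; ring

lemma pow_test2 {c θ : ℝ} (α : ℝ) (hc1 : 1 < c) (hc2 : c < 2) (hθ : θ ≠ 0) {t : ℕ} (ht : 1 ≤ t) :
    ‖∑ n ∈ Finset.range t, e (ph c θ α n)‖ ≤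
      16 * dd c * (Real.sqrt |θ| * (t:ℝ) ^ (c/2)) + 8 * (|θ| * (t:ℝ) ^ (c-1)) +
        8 * dd c * ((t:ℝ) ^ (1 - c/2) / Real.sqrt |θ|) + 4 := by
  have hT : (1:ℝ) ≤ t := by exact_mod_cast ht
  have hT0 : (0:ℝ) < t := by linarith
  refine (pow_test α hc1 hc2 hθ ht).trans (le_of_eq ?_)
  rw [div_sqrt_split hc1 hT]
  have hs : Real.sqrt |θ| ^ 2 = |θ| := Real.sq_sqrt (abs_nonneg _)
  have hs0 : 0 < Real.sqrt |θ| := Real.sqrt_pos.2 (abs_pos.2 hθ)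
  have h1 : |θ| * (t:ℝ) ^ (c-1) * ((t:ℝ) ^ (1 - c/2) / Real.sqrt |θ|) = Real.sqrt |θ| * (t:ℝ) ^ (c/2) := by
    have : (t:ℝ) ^ (c/2) = (t:ℝ) ^ (c-1) * (t:ℝ) ^ (1 - c/2) := by
      rw [← Real.rpow_add hT0]; congr 1; ring
    rw [this]
    nth_rewrite 1 [← hs]
    field_simp
  linear_combination (16 * dd c) * h1

lemma pow_test3 {c θ : ℝ} (α : ℝ) (hc1 : 1 < c) (hc2 : c < 2) {t : ℕ} (ht : 1 ≤ t)
    (h1 : 1/2 ≤ |θ|) (h2 : |θ| ≤ 9 * (t:ℝ) ^ (2 - c)) :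
    ‖∑ n ∈ Finset.range t, e (ph c θ α n)‖ ≤
      (32 * dd c + 32) * (Real.sqrt |θ| * (t:ℝ) ^ (c/2)) := by
  have hT : (1:ℝ) ≤ t := by exact_mod_cast ht
  have hT0 : (0:ℝ) < t := by linarith
  have hθ : θ ≠ 0 := abs_pos.1 (by linarith)
  refine (pow_test2 α hc1 hc2 hθ ht).trans ?_
  have hs : Real.sqrt |θ| ^ 2 = |θ| := Real.sq_sqrt (abs_nonneg _)
  set a := Real.sqrt |θ| with ha
  have hs0 : 0 < a := Real.sqrt_pos.2 (abs_pos.2 hθ)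
  have ha2 : 1/2 ≤ a := by nlinarith
  have hp : 1 ≤ (t:ℝ) ^ (c/2) := Real.one_le_rpow hT (by linarith)
  have hd := dd_nonneg c
  have hup : a ≤ 3 * (t:ℝ) ^ (1 - c/2) := by
    have e1 : (t:ℝ) ^ (2 - c) = ((t:ℝ) ^ (1 - c/2)) ^ 2 := by
      rw [← Real.rpow_natCast, ← Real.rpow_mul hT0.le]; congr 1; push_cast; ring
    have h0 : 0 ≤ 3 * (t:ℝ) ^ (1 - c/2) := by positivity
    rw [ha, Real.sqrt_le_left h0]
    rw [e1] at h2; nlinarith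
  have b1 : |θ| * (t:ℝ) ^ (c-1) ≤ 3 * (a * (t:ℝ) ^ (c/2)) := by
    have : (t:ℝ) ^ (c/2) = (t:ℝ) ^ (c-1) * (t:ℝ) ^ (1 - c/2) := by
      rw [← Real.rpow_add hT0]; congr 1; ring
    rw [this, ← hs]
    have h0 : 0 ≤ a * (t:ℝ) ^ (c-1) := by positivity
    nlinarith [mul_le_mul_of_nonneg_left hup h0]
  have b2 : (t:ℝ) ^ (1 - c/2) / a ≤ 2 * (a * (t:ℝ) ^ (c/2)) := by
    rw [div_le_iff₀ hs0]
    have h3 : (t:ℝ) ^ (1 - c/2) ≤ (t:ℝ) ^ (c/2) := Real.rpow_le_rpow_of_exponent_le hT (by linarith)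
    nlinarith
  have b3 : 4 ≤ 8 * (a * (t:ℝ) ^ (c/2)) := by nlinarith
  have := mul_le_mul_of_nonneg_left b2 (by linarith : 0 ≤ 8 * dd c)
  nlinarith

lemma main_bound {c ε : ℝ} (hc1 : 1 < c) (hc2 : c < 2) (hε1 : 0 < ε) (hε2 : ε < 1/4) (hε3 : ε < 2 - c)
    {t : ℕ} (ht : 1 ≤ t) {ξ α : ℝ} (hξ : |ξ| ≤ 1/2) (hα : |α| ≤ 1/2) :
    ‖∑ n ∈ Finset.range t, e (ξ * ⌊((n:ℝ) + 1) ^ c⌋ + α * ((n:ℝ) + 1)) -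
      ∫ s in (0:ℝ)..t, e (ξ * s ^ c + α * s)‖ ≤ (10000 * dd c + 10000) * (t:ℝ) ^ (1 - ε/4) := by
  have hT : (1:ℝ) ≤ t := by exact_mod_cast ht
  have hT0 : (0:ℝ) < t := by linarith
  have mono : ∀ {a b : ℝ}, a ≤ b → (t:ℝ) ^ a ≤ (t:ℝ) ^ b := fun h => Real.rpow_le_rpow_of_exponent_le hT h
  have hd := dd_nonneg c
  set Z := (t:ℝ) ^ (1 - ε/4) with hZ
  have hZ1 : 1 ≤ Z := Real.one_le_rpow hT (by linarith)
  rcases lt_or_ge |ξ| ((t:ℝ) ^ (ε - c)) with hsmall | hbig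
  · have hfl : ‖∑ n ∈ Finset.range t, e (ξ * ⌊((n:ℝ) + 1) ^ c⌋ + α * ((n:ℝ) + 1)) -
        ∑ n ∈ Finset.range t, e (ph c ξ α n)‖ ≤ 8 * Z := by
      rw [← Finset.sum_sub_distrib]
      have : ∀ n ∈ Finset.range t, ‖e (ξ * ⌊((n:ℝ) + 1) ^ c⌋ + α * ((n:ℝ) + 1)) - e (ph c ξ α n)‖ ≤
          8 * (t:ℝ) ^ (ε - c) := by
        intro n _
        refine (norm_e_sub _ _).trans ?_
        have h1 : ξ * ⌊((n:ℝ) + 1) ^ c⌋ + α * ((n:ℝ) + 1) - ph c ξ α n = -(ξ * Int.fract (((n:ℝ) + 1) ^ c)) := by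
          unfold ph; rw [← Int.self_sub_floor]; ring
        rw [h1, abs_neg, abs_mul, abs_of_nonneg (Int.fract_nonneg (((n:ℝ) + 1) ^ c))]
        have h2 : |ξ| * Int.fract (((n:ℝ) + 1) ^ c) ≤ (t:ℝ) ^ (ε - c) * 1 :=
          mul_le_mul hsmall.le (Int.fract_lt_one _).le (Int.fract_nonneg _) (by positivity)
        have hp := Real.pi_lt_four
        have := Real.pi_pos
        have h0 : 0 ≤ (t:ℝ) ^ (ε - c) := by positivity
        nlinarith [mul_le_mul_of_nonneg_left h2 Real.two_pi_pos.le]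
      refine (norm_sum_le _ _).trans ((Finset.sum_le_sum this).trans ?_)
      simp only [Finset.sum_const, Finset.card_range, nsmul_eq_mul]
      have h3 : (t:ℝ) * (t:ℝ) ^ (ε - c) = (t:ℝ) ^ (1 + (ε - c)) := by
        rw [Real.rpow_add hT0, Real.rpow_one]
      have h4 : (t:ℝ) ^ (1 + (ε - c)) ≤ Z := mono (by linarith)
      nlinarith
    have hξc : |ξ| * (t:ℝ) ^ (c-1) ≤ (t:ℝ) ^ (ε - 1) := by
      have : (t:ℝ) ^ (ε - 1) = (t:ℝ) ^ (ε - c) * (t:ℝ) ^ (c-1) := by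
        rw [← Real.rpow_add hT0]; congr 1; ring
      rw [this]; gcongr
    set S := ∑ n ∈ Finset.range t, e (ξ * ⌊((n:ℝ) + 1) ^ c⌋ + α * ((n:ℝ) + 1))
    set S' := ∑ n ∈ Finset.range t, e (ph c ξ α n) with hS'
    set I := ∫ s in (0:ℝ)..t, e (ξ * s ^ c + α * s) with hI
    have tri : ‖S - I‖ ≤ 8 * Z + ‖S' - I‖ := by
      have := norm_add_le (S - S') (S' - I)
      rw [sub_add_sub_cancel] at this
      linarith
    have tri2 := norm_sub_le S' I
    refine tri.trans ?_
    suffices ‖S' - I‖ ≤ 100 * Z by nlinarith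
    rcases le_or_gt |α| ((t:ℝ) ^ (2 * ε - 1)) with h1 | h1
    · have := box_compare (c := c) (ξ := ξ) (α := α) hc1 hc2 t
      rw [norm_sub_rev] at this
      refine this.trans ?_
      have h2 : (t:ℝ) ^ (ε - 1) ≤ (t:ℝ) ^ (2 * ε - 1) := mono (by linarith)
      have h3 : (t:ℝ) * (t:ℝ) ^ (2 * ε - 1) = (t:ℝ) ^ (1 + (2 * ε - 1)) := by
        rw [Real.rpow_add hT0, Real.rpow_one]
      have h4 : (t:ℝ) ^ (1 + (2 * ε - 1)) ≤ Z := mono (by linarith)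
      rw [← h3] at h4
      have h5 : 2 * |ξ| * (t:ℝ) ^ (c-1) + |α| ≤ 3 * (t:ℝ) ^ (2 * ε - 1) := by linarith
      calc (t:ℝ) * (2 * Real.pi * (2 * |ξ| * (t:ℝ) ^ (c-1) + |α|))
          ≤ (t:ℝ) * (2 * 4 * (3 * (t:ℝ) ^ (2 * ε - 1))) := by
            have := Real.pi_lt_four.le
            gcongr
        _ ≤ _ := by nlinarith
    · have hαpos : 0 < |α| := lt_of_le_of_lt (by positivity) h1
      have hα0 : α ≠ 0 := abs_pos.1 hαpos
      rcases le_or_gt 8 ((t:ℝ) ^ ε) with h2 | h2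
      · have h8 : 8 * |ξ| * (t:ℝ) ^ (c-1) ≤ |α| := by
          have : (t:ℝ) ^ (2 * ε - 1) = (t:ℝ) ^ ε * (t:ℝ) ^ (ε - 1) := by
            rw [← Real.rpow_add hT0]; congr 1; ring
          have h0 : 0 ≤ (t:ℝ) ^ (ε - 1) := by positivity
          nlinarith
        have a1 := first_test hc1 hc2 hα0 h8 hα
        have a2 := integral_first hc1 hc2 hξ hα ht hα0 h8
        have a3 : 4 / |α| ≤ 4 * Z := by
          have : 1 / |α| ≤ Z := by
            calc 1 / |α| ≤ 1 / (t:ℝ) ^ (2 * ε - 1) := by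
                  apply one_div_le_one_div_of_le (by positivity) h1.le
              _ = (t:ℝ) ^ (-(2 * ε - 1)) := by rw [Real.rpow_neg hT0.le, one_div]
              _ ≤ Z := mono (by linarith)
          have e4 : 4 / |α| = 4 * (1 / |α|) := by ring
          rw [e4]; linarith
        linarith
      · have a1 : ‖S'‖ ≤ t := by
          have := norm_sum_e_le (ph c ξ α) 0 t
          rw [hS', Finset.range_eq_Ico]
          refine this.trans ?_
          simp
        have a2 : ‖I‖ ≤ t := by
          have := intervalIntegral.norm_integral_le_of_norm_le_const (a := 0) (b := (t:ℝ))
            (f := fun s => e (ξ * s ^ c + α * s)) (C := 1) (fun u _ => (norm_e _).le)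
          simpa using this
        have a3 : (t:ℝ) ≤ 2 * Z := by
          have e1 : (t:ℝ) = (t:ℝ) ^ (ε/4) * Z := by
            rw [hZ, ← Real.rpow_add hT0]; simp
          have e2 : (t:ℝ) ^ (ε/4) ≤ 2 := by
            by_contra hcon
            push Not at hcon
            have e3 : (t:ℝ) ^ ε = ((t:ℝ) ^ (ε/4)) ^ 4 := by
              rw [← Real.rpow_natCast, ← Real.rpow_mul hT0.le]; congr 1; push_cast; ring
            have : (2:ℝ)^4 ≤ ((t:ℝ) ^ (ε/4)) ^ 4 := by gcongr
            rw [e3] at h2; linarith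
          have e5 := mul_le_mul_of_nonneg_right e2 (by linarith : 0 ≤ Z)
          linarith
        linarith
  · have hpos : 0 < |ξ| := lt_of_lt_of_le (by positivity) hbig
    have hξ0 : ξ ≠ 0 := abs_pos.1 hpos
    set X := (t:ℝ) ^ (ε/4) with hX
    have hX1 : 1 ≤ X := Real.one_le_rpow hT (by linarith)
    set K := ⌈X⌉₊ with hK
    have hKX : X ≤ K := Nat.le_ceil X
    have hK2 : (K:ℝ) ≤ 2 * X := by
      have := Nat.ceil_lt_add_one (by linarith : 0 ≤ X)
      linarith
    have hK1 : 1 ≤ K := Nat.one_le_iff_ne_zero.2 (by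
      intro h; rw [h] at hKX; simp at hKX; linarith)
    have hXX : X ^ 2 ≤ (t:ℝ) ^ (2 - c) := by
      have : X ^ 2 = (t:ℝ) ^ (ε/2) := by
        rw [hX, ← Real.rpow_natCast, ← Real.rpow_mul hT0.le]; congr 1; push_cast; ring
      rw [this]; exact mono (by linarith)
    have hq : (t:ℝ) ^ (1 - c/2) / Real.sqrt |ξ| ≤ Z := by
      have h1 : (t:ℝ) ^ ((ε - c)/2) ≤ Real.sqrt |ξ| := by
        apply Real.le_sqrt_of_sq_le
        have : ((t:ℝ) ^ ((ε - c)/2)) ^ 2 = (t:ℝ) ^ (ε - c) := by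
          rw [← Real.rpow_natCast, ← Real.rpow_mul hT0.le]; congr 1; push_cast; ring
        rw [this]; exact hbig
      calc (t:ℝ) ^ (1 - c/2) / Real.sqrt |ξ| ≤ (t:ℝ) ^ (1 - c/2) / (t:ℝ) ^ ((ε - c)/2) := by gcongr
        _ = (t:ℝ) ^ (1 - c/2 - (ε - c)/2) := (Real.rpow_sub hT0 _ _).symm
        _ ≤ Z := mono (by linarith)
    have hI := integral_second hc1 hc2 hξ hα ht hξ0
    rw [div_sqrt_split hc1 hT] at hI
    have hI2 : ‖∫ s in (0:ℝ)..t, e (ξ * s ^ c + α * s)‖ ≤ (16 * dd c + 24) * Z := by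
      have := mul_le_mul_of_nonneg_left hq (by linarith : 0 ≤ 16 * dd c)
      linarith
    have hB0 : ‖∑ n ∈ Finset.range t, e (ph c ξ α n)‖ ≤ (24 * dd c + 8) * Z := by
      refine (pow_test2 α hc1 hc2 hξ0 ht).trans ?_
      have b1 : Real.sqrt |ξ| * (t:ℝ) ^ (c/2) ≤ Z := by
        have h1 : Real.sqrt |ξ| ≤ 1 := by rw [Real.sqrt_le_left zero_le_one]; linarith
        calc _ ≤ 1 * (t:ℝ) ^ (c/2) := by gcongr
          _ ≤ Z := by rw [one_mul]; exact mono (by linarith)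
      have b2 : |ξ| * (t:ℝ) ^ (c-1) ≤ 1/2 * Z := by
        have : (t:ℝ) ^ (c-1) ≤ Z := mono (by linarith)
        gcongr
      have := mul_le_mul_of_nonneg_left hq (by linarith : 0 ≤ 8 * dd c)
      have := mul_le_mul_of_nonneg_left b1 (by linarith : 0 ≤ 16 * dd c)
      linarith
    set B := (32 * dd c + 32) * (2 * (t:ℝ) ^ (c/2)) with hB
    have hBn : 0 ≤ B := by positivity
    have hjb : ∀ (j : ℤ) (ω α' : ℝ), |ω| ≤ 1/2 → j ≠ 0 → |j| < (K:ℤ)^2 →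
        ‖∑ n ∈ Finset.range t, e (ph c (ω + j) α' n)‖ ≤ B * Real.sqrt |(j:ℝ)| := by
      intro j ω α' hω hj hjK
      have hge : (1:ℝ) ≤ |(j:ℝ)| := by
        have : 1 ≤ |j| := Int.one_le_abs hj
        exact_mod_cast this
      have hle : |(j:ℝ)| ≤ (K:ℝ)^2 := by exact_mod_cast hjK.le
      have hlo : |(j:ℝ)| - |ω| ≤ |ω + j| := by
        have := abs_sub_abs_le_abs_sub (j:ℝ) (-ω)
        rwa [abs_neg, sub_neg_eq_add, add_comm (j:ℝ) ω] at this
      have hup := abs_add_le ω (j:ℝ)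
      have hKsq : (K:ℝ)^2 ≤ 4 * (t:ℝ) ^ (2 - c) := by nlinarith
      refine (pow_test3 α' hc1 hc2 ht (by linarith) (by linarith)).trans ?_
      rw [hB]
      have h3 : Real.sqrt |ω + j| ≤ 2 * Real.sqrt |(j:ℝ)| := by
        rw [Real.sqrt_le_left (by positivity), mul_pow, Real.sq_sqrt (abs_nonneg _)]
        linarith
      calc (32 * dd c + 32) * (Real.sqrt |ω + j| * (t:ℝ) ^ (c/2))
          ≤ (32 * dd c + 32) * ((2 * Real.sqrt |(j:ℝ)|) * (t:ℝ) ^ (c/2)) := by gcongr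
        _ = _ := by ring
    have hF := floor_sum (t := t) hK1 (fun n => ((n:ℝ) + 1) ^ c) (fun n => α * ((n:ℝ) + 1)) hξ
      (B0 := (24 * dd c + 8) * Z) (B := B) (by positivity) hBn hB0
      (fun j hj hjK => hjb j ξ α hξ hj hjK)
      (fun j hj hjK => by
        have := hjb j 0 0 (by norm_num) hj hjK
        simpa [ph] using this)
    have g1 : 21 * (t:ℝ) / K ≤ 21 * Z := by
      have e1 : (t:ℝ) = X * Z := by
        rw [hZ, hX, ← Real.rpow_add hT0]; simp
      rw [div_le_iff₀ (by linarith)]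
      nlinarith
    have g2 : B * K ≤ (128 * dd c + 128) * Z := by
      have e1 : X * (t:ℝ) ^ (c/2) ≤ Z := by
        rw [hX, ← Real.rpow_add hT0]; exact mono (by linarith)
      calc B * K ≤ B * (2 * X) := by gcongr
        _ = (128 * dd c + 128) * (X * (t:ℝ) ^ (c/2)) := by rw [hB]; ring
        _ ≤ _ := by gcongr
    have hdZ : 0 ≤ dd c * Z := by positivity
    refine (norm_sub_le _ _).trans ((add_le_add hF hI2).trans ?_)
    clear hF hI2 hI hjb hB0
    generalize B * (K:ℝ) = BK at *
    generalize 21 * (t:ℝ) / K = tK at *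
    linarith

theorem stmt10 (c ε : ℝ) (hc1 : 1 < c) (hc2 : c < 2)
    (hε1 : 0 < ε) (hε2 : ε < min (1/4) (2 - c)) :
    ∃ C > (0 : ℝ), ∀ (t : ℕ), 1 ≤ t → ∀ (ξ₁ ξ₂ : ℝ),
      ξ₁ ∈ Set.Ico (-(1/2) : ℝ) (1/2) → ξ₂ ∈ Set.Ico (-(1/2) : ℝ) (1/2) →
      ‖((t : ℂ))⁻¹ * ∑ n ∈ Finset.Icc 1 t,
            e (-(ξ₂ * (⌊(n : ℝ) ^ c⌋ : ℝ) + ξ₁ * n)) -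
          ((t : ℂ))⁻¹ * ∫ s in (0 : ℝ)..(t : ℝ), e (-(ξ₂ * s ^ c + ξ₁ * s))‖ ≤
        C * (t : ℝ) ^ (-(ε / 4)) := by
  have hd := dd_nonneg c
  refine ⟨10000 * dd c + 10000, by positivity, ?_⟩
  intro t ht ξ₁ ξ₂ h1 h2
  have hT : (1:ℝ) ≤ t := by exact_mod_cast ht
  have hT0 : (0:ℝ) < t := by linarith
  have hm := main_bound hc1 hc2 hε1 (lt_of_lt_of_le hε2 (min_le_left _ _)) (lt_of_lt_of_le hε2 (min_le_right _ _)) ht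
    (ξ := -ξ₂) (α := -ξ₁) (by rw [abs_neg, abs_le]; exact ⟨h2.1, h2.2.le⟩) (by rw [abs_neg, abs_le]; exact ⟨h1.1, h1.2.le⟩)
  have e1 : ∑ n ∈ Finset.Icc 1 t, e (-(ξ₂ * (⌊(n : ℝ) ^ c⌋ : ℝ) + ξ₁ * n)) =
      ∑ n ∈ Finset.range t, e (-ξ₂ * ⌊((n:ℝ) + 1) ^ c⌋ + -ξ₁ * ((n:ℝ) + 1)) := by
    have : Finset.Icc 1 t = Finset.Ico 1 (t+1) := by ext; simp
    rw [this, Finset.sum_Ico_eq_sum_range]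
    refine Finset.sum_congr (by simp) fun n _ => ?_
    push_cast
    rw [add_comm (1:ℝ) n]
    congr 1; ring
  have e2 : ∀ s : ℝ, -(ξ₂ * s ^ c + ξ₁ * s) = -ξ₂ * s ^ c + -ξ₁ * s := fun s => by ring
  simp only [e2]
  rw [e1, ← mul_sub, norm_mul]
  have e3 : ‖(t:ℂ)⁻¹‖ = (t:ℝ)⁻¹ := by simp
  rw [e3]
  have e4 : (t:ℝ) ^ (-(ε/4)) = (t:ℝ)⁻¹ * (t:ℝ) ^ (1 - ε/4) := by
    rw [← Real.rpow_neg_one, ← Real.rpow_add hT0]; congr 1; ring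
  rw [e4, mul_left_comm]
  exact mul_le_mul_of_nonneg_left hm (by positivity)
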